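/- arXiv:1503.02227 — 4 statements merged into one kernel-verified Lean document; each statement's English description precedes it below -/
import Mathlib

section
/- Let n ≥ 1. The twisted hyperoctahedral group H̃_n is a finite group of order 2^{n+1}·n!. -/
/-!
The twisted hyperoctahedral group `H̃ₙ`, presented by generators
`s₁, …, s_{n−1}`, `a₁, …, aₙ`, `z` (here indexed by `Fin (n-1)`, `Fin n`),
with the relations of the paper.  STATEMENT 0: for `n ≥ 1`, `H̃ₙ` is a finite
group of order `2^(n+1) * n!`.
-/

namespace SpinHyperoctahedral

/-- Generators of the twisted hyperoctahedral group: `s i` for `1 ≤ i ≤ n-1`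
(indexed by `Fin (n-1)`), `a j` for `1 ≤ j ≤ n` (indexed by `Fin n`), and `z`. -/
inductive HGen (n : ℕ) : Type
  | s : Fin (n - 1) → HGen n
  | a : Fin n → HGen n
  | z : HGen n

variable {n : ℕ}

/-- The free-group letter corresponding to `sᵢ`. -/
def S (i : Fin (n - 1)) : FreeGroup (HGen n) := FreeGroup.of (HGen.s i)

/-- The free-group letter corresponding to `aⱼ`. -/
def A (j : Fin n) : FreeGroup (HGen n) := FreeGroup.of (HGen.a j)

/-- The free-group letter corresponding to `z`. -/
def Z : FreeGroup (HGen n) := FreeGroup.of (HGen.z)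

/-- For `i` indexing `sᵢ`, the index of `aᵢ`. -/
def idx1 (i : Fin (n - 1)) : Fin n := ⟨(i : ℕ), by have := i.isLt; omega⟩

/-- For `i` indexing `sᵢ`, the index of `a_{i+1}`. -/
def idx2 (i : Fin (n - 1)) : Fin n := ⟨(i : ℕ) + 1, by have := i.isLt; omega⟩

/-- The defining relations of the twisted hyperoctahedral group `H̃ₙ`:
`z` is central, `z² = 1`, `sᵢ² = 1`, `(sᵢs_{i+1})³ = 1`, `(sᵢsⱼ)² = 1` for
`|i−j| ≥ 2`, `sᵢ aᵢ sᵢ⁻¹ = a_{i+1}`, `sᵢ aⱼ sᵢ⁻¹ = aⱼ` for `j ≠ i, i+1`,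
`aⱼ² = z`, and `aᵢaⱼ = z aⱼaᵢ` for `i ≠ j`. -/
def hRels (n : ℕ) : Set (FreeGroup (HGen n)) :=
  { w | (∃ i : Fin (n - 1), w = Z * S i * Z⁻¹ * (S i)⁻¹)
    ∨ (∃ j : Fin n, w = Z * A j * Z⁻¹ * (A j)⁻¹)
    ∨ (w = Z ^ 2)
    ∨ (∃ i : Fin (n - 1), w = S i ^ 2)
    ∨ (∃ i j : Fin (n - 1), (j : ℕ) = (i : ℕ) + 1 ∧ w = (S i * S j) ^ 3)
    ∨ (∃ i j : Fin (n - 1), ((i : ℕ) + 2 ≤ (j : ℕ) ∨ (j : ℕ) + 2 ≤ (i : ℕ)) ∧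
        w = (S i * S j) ^ 2)
    ∨ (∃ i : Fin (n - 1), w = S i * A (idx1 i) * (S i)⁻¹ * (A (idx2 i))⁻¹)
    ∨ (∃ (i : Fin (n - 1)) (j : Fin n), (j : ℕ) ≠ (i : ℕ) ∧ (j : ℕ) ≠ (i : ℕ) + 1 ∧
        w = S i * A j * (S i)⁻¹ * (A j)⁻¹)
    ∨ (∃ j : Fin n, w = A j ^ 2 * Z⁻¹)
    ∨ (∃ i j : Fin n, i ≠ j ∧ w = A i * A j * (A i)⁻¹ * (A j)⁻¹ * Z⁻¹) }

/-- The twisted hyperoctahedral group `H̃ₙ` as a presented group. -/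
abbrev HTilde (n : ℕ) := PresentedGroup (hRels n)

section UpperBound

open scoped Pointwise

variable {G : Type*} [Group G]

/-- If left multiplication by each element of `X` permutes finitely many cosets `t i * K`, one of
which is `K`, then these cosets cover the subgroup generated by `X`. -/
theorem finite_closure_and_card_le {ι : Type*} [Finite ι] (K : Subgroup G) [Finite K] (t : ι → G)
    (X : Set G) (i₀ : ι) (hi₀ : t i₀ = 1)
    (hX : ∀ x ∈ X, ∀ i, ∃ j, ∃ k ∈ K, x * t i = t j * k) :
    Finite (Subgroup.closure X) ∧
      Nat.card (Subgroup.closure X) ≤ Nat.card ι * Nat.card K := by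
  let T : Set (G ⧸ K) := Set.range fun i => (t i : G ⧸ K)
  have hT : T.Finite := Set.finite_range _
  have hstab : Subgroup.closure X ≤ MulAction.stabilizer G T := by
    rw [Subgroup.closure_le]
    intro x hx
    refine (MulAction.mem_stabilizer_set' hT).2 ?_
    rintro _ ⟨i, rfl⟩
    obtain ⟨j, k, hk, h⟩ := hX x hx i
    refine ⟨j, ?_⟩
    rw [MulAction.Quotient.smul_coe, smul_eq_mul, h]
    exact QuotientGroup.eq.2 (by simpa using hk)
  have hsub : (Subgroup.closure X : Set G) ⊆
      Set.range fun p : ι × K => t p.1 * (p.2 : G) := by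
    intro g hg
    obtain ⟨j, hj⟩ := (MulAction.mem_stabilizer_set' hT).1 (hstab hg)
      (⟨i₀, rfl⟩ : ((t i₀ : G) : G ⧸ K) ∈ T)
    rw [MulAction.Quotient.smul_coe, smul_eq_mul, hi₀, mul_one] at hj
    exact ⟨(j, ⟨_, QuotientGroup.eq.1 hj⟩), by simp⟩
  have hfin := Set.finite_range fun p : ι × K => t p.1 * (p.2 : G)
  refine ⟨hfin.subset hsub, (Nat.card_mono hfin hsub).trans ?_⟩
  exact (Finite.card_range_le _).trans_eq (Nat.card_prod _ _)

/-- Pairwise commuting up to a central involution, `k` square roots of that involution generate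
a group of order at most `2 ^ (k + 1)`. -/
theorem finite_closure_insert_and_card_le {n : ℕ} (a : Fin n → G) (z : G)
    (hz : ∀ j, Commute z (a j)) (hz2 : z ^ 2 = 1) (ha : ∀ j, a j ^ 2 = z)
    (hac : ∀ i j, i ≠ j → a i * a j = z * (a j * a i)) (k : ℕ) (hk : k ≤ n) :
    Finite (Subgroup.closure (insert z (a '' {j | (j : ℕ) < k}))) ∧
      Nat.card (Subgroup.closure (insert z (a '' {j | (j : ℕ) < k}))) ≤ 2 ^ (k + 1) := by
  induction k with
  | zero =>
    have := finite_closure_and_card_le (⊥ : Subgroup G) (fun b : Bool => if b then z else 1)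
      (insert z (a '' {j | (j : ℕ) < 0})) false (by simp) (by
        intro x hx b
        obtain rfl : x = z := by simpa using hx
        cases b
        · exact ⟨true, 1, one_mem _, by simp⟩
        · exact ⟨false, 1, one_mem _, by simpa [pow_two] using hz2⟩)
    simpa using this
  | succ k ih =>
    obtain ⟨hfin, hcard⟩ := ih (by omega)
    set K := Subgroup.closure (insert z (a '' {j | (j : ℕ) < k}))
    have hzK : z ∈ K := Subgroup.subset_closure (Set.mem_insert _ _)
    have haK : ∀ j : Fin n, (j : ℕ) < k → a j ∈ K := fun j hj =>
      Subgroup.subset_closure (Set.mem_insert_of_mem _ ⟨j, hj, rfl⟩)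
    let c : Fin n := ⟨k, hk⟩
    have := finite_closure_and_card_le K (fun b : Bool => if b then a c else 1)
      (insert z (a '' {j | (j : ℕ) < k + 1})) false (by simp) (by
        rintro x (rfl | ⟨j, hj, rfl⟩) b
        · cases b
          · exact ⟨false, x, hzK, by simp⟩
          · exact ⟨true, x, hzK, by simpa using (hz c).eq⟩
        · rcases Nat.lt_succ_iff_lt_or_eq.1 hj with hj | hj
          · cases b
            · exact ⟨false, a j, haK j hj, by simp⟩
            · refine ⟨true, z * a j, mul_mem hzK (haK j hj), ?_⟩
              have hjc : j ≠ c := fun h => by simp [h, c] at hj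
              simp only [if_true]
              rw [hac j c hjc, ← mul_assoc, ← mul_assoc, (hz c).eq]
          · obtain rfl : j = c := Fin.ext hj
            cases b
            · exact ⟨true, 1, one_mem _, by simp⟩
            · exact ⟨false, z, hzK, by simpa [pow_two] using ha c⟩)
    refine ⟨this.1, this.2.trans ?_⟩
    rw [Nat.card_eq_fintype_card, Fintype.card_bool, pow_succ' 2 (k + 1)]
    gcongr

/-- The product `s j * s (j + 1) * ⋯ * s (j + d - 1)`. -/
def ascProd (s : ℕ → G) : ℕ → ℕ → G
  | _, 0 => 1
  | j, d + 1 => s j * ascProd s (j + 1) d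

theorem commute_ascProd {s : ℕ → G} {m : ℕ}
    (hcomm : ∀ i j, i + 1 < j → j < m → Commute (s i) (s j)) {i : ℕ} (d j : ℕ)
    (hij : i + 1 < j) (hj : j + d ≤ m) : Commute (s i) (ascProd s j d) := by
  induction d generalizing j with
  | zero => exact Commute.one_right _
  | succ d ih =>
    exact (hcomm i j hij (by omega)).mul_right (ih (j + 1) (by omega) (by omega))

theorem mul_ascProd {s : ℕ → G} {m : ℕ}
    (hbraid : ∀ i, i + 1 < m → s i * s (i + 1) * s i = s (i + 1) * s i * s (i + 1))
    (hcomm : ∀ i j, i + 1 < j → j < m → Commute (s i) (s j)) {i : ℕ} (d j : ℕ)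
    (hji : j ≤ i) (hid : i + 1 < j + d) (hj : j + d ≤ m) :
    s (i + 1) * ascProd s j d = ascProd s j d * s i := by
  induction d generalizing j with
  | zero => omega
  | succ d ih =>
    rcases hji.lt_or_eq with h | rfl
    · rw [ascProd, ← mul_assoc, ← (hcomm j (i + 1) (by omega) (by omega)).eq, mul_assoc,
        ih (j + 1) (by omega) (by omega) (by omega), mul_assoc]
    · obtain ⟨d, rfl⟩ : ∃ e, d = e + 1 := ⟨d - 1, by omega⟩
      have h := (commute_ascProd hcomm (i := j) d (j + 1 + 1) (by omega) (by omega)).eq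
      simp only [ascProd]
      rw [mul_assoc, mul_assoc, ← h]
      simp only [← mul_assoc]
      rw [hbraid j (by omega)]

/-- A finite normal subgroup `N` and the first `k` Coxeter generators of type `A` generate a group
of order at most `(k + 1)! * |N|`. -/
theorem finite_closure_union_and_card_le (N : Subgroup G) [N.Normal] [Finite N] {s : ℕ → G} {m : ℕ}
    (hsq : ∀ i < m, s i * s i = 1)
    (hbraid : ∀ i, i + 1 < m → s i * s (i + 1) * s i = s (i + 1) * s i * s (i + 1))
    (hcomm : ∀ i j, i + 1 < j → j < m → Commute (s i) (s j)) (k : ℕ) (hk : k ≤ m) :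
    Finite (Subgroup.closure ((N : Set G) ∪ s '' Set.Iio k)) ∧
      Nat.card (Subgroup.closure ((N : Set G) ∪ s '' Set.Iio k)) ≤
        (k + 1).factorial * Nat.card N := by
  induction k with
  | zero =>
    simp only [Set.Iio_zero_eq_empty, Set.image_empty, Set.union_empty]
    rw [Subgroup.closure_eq]
    exact ⟨inferInstance, by simp⟩
  | succ k ih =>
    obtain ⟨hfin, hcard⟩ := ih (by omega)
    set K := Subgroup.closure ((N : Set G) ∪ s '' Set.Iio k)
    have hNK : ∀ x ∈ N, x ∈ K := fun x hx => Subgroup.subset_closure (Or.inl hx)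
    have hsK : ∀ i < k, s i ∈ K := fun i hi => Subgroup.subset_closure (Or.inr ⟨i, hi, rfl⟩)
    have := finite_closure_and_card_le K
      (fun j : Fin (k + 2) => ascProd s j (k + 1 - j))
      ((N : Set G) ∪ s '' Set.Iio (k + 1)) (Fin.last _) (by simp [ascProd]) (by
        rintro x (hx | ⟨i, hi, rfl⟩) ⟨j, hj⟩
        · refine ⟨⟨j, hj⟩, _, hNK _ (‹N.Normal›.conj_mem x hx (ascProd s j (k + 1 - j))⁻¹), ?_⟩
          simp [mul_assoc]
        · have hi : i < k + 1 := hi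
          rcases lt_or_ge (i + 1) j with h | h
          · exact ⟨⟨j, hj⟩, s i, hsK i (by omega),
              commute_ascProd hcomm _ j h (by dsimp only; omega)⟩
          rcases h.eq_or_lt with rfl | h
          · refine ⟨⟨i, by omega⟩, 1, one_mem _, ?_⟩
            have : k + 1 - i = (k + 1 - (i + 1)) + 1 := by omega
            simp only [this, ascProd, mul_one]
          rcases (Nat.lt_succ_iff.1 h).eq_or_lt with rfl | h
          · refine ⟨⟨j + 1, by omega⟩, 1, one_mem _, ?_⟩
            have : k + 1 - j = (k + 1 - (j + 1)) + 1 := by omega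
            simp only [this, ascProd, mul_one]
            rw [← mul_assoc, hsq j (by omega), one_mul]
          · obtain ⟨i, rfl⟩ : ∃ e, i = e + 1 := ⟨i - 1, by omega⟩
            exact ⟨⟨j, hj⟩, s i, hsK i (by omega),
              mul_ascProd hbraid hcomm _ j (by omega) (by dsimp only; omega)
                (by dsimp only; omega)⟩)
    refine ⟨this.1, this.2.trans ?_⟩
    rw [Nat.card_eq_fintype_card, Fintype.card_fin, Nat.factorial_succ (k + 1), mul_assoc]
    gcongr

end UpperBound

section Models

variable {G : Type*} [Group G]

/-- The adjacent transposition corresponding to `sᵢ`. -/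
def adjSwap (i : Fin (n - 1)) : Equiv.Perm (Fin n) := Equiv.swap (idx1 i) (idx2 i)

/-- The images of the generators of `H̃ₙ` determined by an action `p` of the symmetric group,
elements `a` permuted by it, and an element `z`. -/
def genImage (p : Equiv.Perm (Fin n) →* G) (a : Fin n → G) (z : G) : HGen n → G
  | .s i => p (adjSwap i)
  | .a j => a j
  | .z => z

theorem lift_genImage_eq_one (p : Equiv.Perm (Fin n) →* G) (a : Fin n → G) (z : G)
    (hpa : ∀ σ j, p σ * a j * (p σ)⁻¹ = a (σ j)) (hpz : ∀ σ, Commute z (p σ))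
    (haz : ∀ j, Commute z (a j)) (hz : z ^ 2 = 1) (ha : ∀ j, a j ^ 2 = z)
    (hac : ∀ i j, i ≠ j → a i * a j = z * (a j * a i)) :
    ∀ w ∈ hRels n, FreeGroup.lift (genImage p a z) w = 1 := by
  rintro w (⟨i, rfl⟩ | ⟨j, rfl⟩ | rfl | ⟨i, rfl⟩ | ⟨i, j, h, rfl⟩ | ⟨i, j, h, rfl⟩ | ⟨i, rfl⟩ |
    ⟨i, j, h, h', rfl⟩ | ⟨j, rfl⟩ | ⟨i, j, h, rfl⟩) <;>
    simp only [S, A, Z, map_mul, map_inv, map_pow, FreeGroup.lift_apply_of, genImage]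
  · rw [(hpz _).eq]; group
  · rw [(haz _).eq]; group
  · exact hz
  · rw [← map_pow, pow_two, adjSwap, Equiv.swap_mul_self, map_one]
  · rw [← map_mul, ← map_pow]
    convert map_one p
    have hj : idx1 j = idx2 i := Fin.ext h
    have h1 : idx1 i ≠ idx2 i := by simp [idx1, idx2]
    have h2 : idx2 i ≠ idx2 j := by simp [idx2, Fin.ext_iff]; omega
    have h3 : idx1 i ≠ idx2 j := by simp [idx1, idx2, Fin.ext_iff]; omega
    rw [adjSwap, adjSwap, hj, Equiv.swap_comm (idx1 i)]
    exact orderOf_dvd_iff_pow_eq_one.1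
      (Equiv.Perm.isThreeCycle_swap_mul_swap_same h1.symm h2 h3).orderOf.dvd
  · rw [← map_mul, ← map_pow]
    convert map_one p
    have hd : Equiv.Perm.Disjoint (adjSwap i) (adjSwap j) := by
      refine Equiv.Perm.disjoint_swap_swap ?_
      simp [idx1, idx2, Fin.ext_iff]; omega
    rw [hd.commute.mul_pow]
    simp [adjSwap, pow_two]
  · rw [hpa, adjSwap, Equiv.swap_apply_left, mul_inv_cancel]
  · rw [hpa, adjSwap, Equiv.swap_apply_of_ne_of_ne, mul_inv_cancel]
    · simpa [idx1, Fin.ext_iff] using h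
    · simpa [idx2, Fin.ext_iff] using h'
  · rw [ha, mul_inv_cancel]
  · rw [hac i j h]; group

/-- The quadratic form `-∑ xᵢ²` on `ℚⁿ`. -/
noncomputable def negSumSquares (n : ℕ) : QuadraticForm ℚ (Fin n → ℚ) :=
  QuadraticMap.weightedSumSquares ℚ fun _ => (-1 : ℚ)

theorem negSumSquares_apply (v : Fin n → ℚ) : negSumSquares n v = -∑ i, v i * v i := by
  simp [negSumSquares, QuadraticMap.weightedSumSquares_apply]

/-- A permutation of the coordinates, as an isometry of `negSumSquares`. -/
noncomputable def permIsometry (σ : Equiv.Perm (Fin n)) : negSumSquares n →qᵢ negSumSquares n where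
  __ := LinearMap.funLeft ℚ ℚ (σ⁻¹ : Equiv.Perm (Fin n))
  map_app' v := by
    simp only [negSumSquares_apply]
    congr 1
    exact Equiv.sum_comp (σ⁻¹ : Equiv.Perm (Fin n)) fun i => v i * v i

theorem permIsometry_apply (σ : Equiv.Perm (Fin n)) (v : Fin n → ℚ) (i : Fin n) :
    permIsometry σ v i = v (σ⁻¹ i) := rfl

/-- The action of the symmetric group on the Clifford algebra of `negSumSquares`. -/
noncomputable def cliffordPerm (n : ℕ) :
    Equiv.Perm (Fin n) →* Module.End ℚ (CliffordAlgebra (negSumSquares n)) where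
  toFun σ := (CliffordAlgebra.map (permIsometry σ)).toLinearMap
  map_one' := by
    have : permIsometry (1 : Equiv.Perm (Fin n)) = QuadraticMap.Isometry.id _ := rfl
    rw [this, CliffordAlgebra.map_id]
    rfl
  map_mul' σ τ := by
    have : permIsometry (σ * τ) = (permIsometry σ).comp (permIsometry τ) := by
      ext v i
      simp [permIsometry_apply]
    rw [this, ← CliffordAlgebra.map_comp_map]
    rfl

/-- The image of the `j`-th basis vector in the Clifford algebra. -/
noncomputable def cliffordGen (j : Fin n) : CliffordAlgebra (negSumSquares n) :=
  CliffordAlgebra.ι _ (Pi.single j 1)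

theorem cliffordGen_mul_self (j : Fin n) : cliffordGen j * cliffordGen j = -1 := by
  rw [cliffordGen, CliffordAlgebra.ι_sq_scalar, negSumSquares_apply]
  simp [Pi.single_apply]

theorem cliffordGen_mul_comm {i j : Fin n} (h : i ≠ j) :
    cliffordGen i * cliffordGen j = -(cliffordGen j * cliffordGen i) := by
  refine CliffordAlgebra.ι_mul_ι_comm_of_isOrtho ?_
  rw [QuadraticMap.isOrtho_def]
  simp only [negSumSquares_apply, ← neg_add, ← Finset.sum_add_distrib]
  congr 1
  refine Finset.sum_congr rfl fun k _ => ?_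
  by_cases hi : k = i
  · subst hi; simp [h]
  · simp [hi]

theorem cliffordPerm_mul_cliffordGen (σ : Equiv.Perm (Fin n)) (j : Fin n)
    (x : CliffordAlgebra (negSumSquares n)) :
    cliffordPerm n σ (cliffordGen j * x) = cliffordGen (σ j) * cliffordPerm n σ x := by
  have : permIsometry σ (Pi.single j 1) = Pi.single (σ j) 1 := by
    ext i
    simp [permIsometry_apply, Pi.single_apply, Equiv.symm_apply_eq, Equiv.Perm.inv_def]
  simp [cliffordPerm, cliffordGen, this]

/-- Left multiplication by `cliffordGen j`, as an invertible endomorphism. -/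
noncomputable def mulCliffordGen (j : Fin n) :
    (Module.End ℚ (CliffordAlgebra (negSumSquares n)))ˣ where
  val := LinearMap.mulLeft ℚ (cliffordGen j)
  inv := -LinearMap.mulLeft ℚ (cliffordGen j)
  val_inv := by
    ext x
    simp [← mul_assoc, cliffordGen_mul_self]
  inv_val := by
    ext x
    simp [← mul_assoc, cliffordGen_mul_self]

/-- The representation of `H̃ₙ` on the Clifford algebra of `negSumSquares`. -/
noncomputable def cliffordRep (n : ℕ) :
    HTilde n →* (Module.End ℚ (CliffordAlgebra (negSumSquares n)))ˣ :=
  PresentedGroup.toGroup (f := genImage (cliffordPerm n).toHomUnits mulCliffordGen (-1)) <|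
    lift_genImage_eq_one _ _ _
      (fun σ j => by
        rw [mul_inv_eq_iff_eq_mul]
        ext x
        exact cliffordPerm_mul_cliffordGen σ j x)
      (fun σ => by ext x; simp) (fun j => by ext x; simp)
      (by ext x; simp [pow_two])
      (fun j => by
        rw [pow_two]
        ext x
        simp [mulCliffordGen, ← mul_assoc, cliffordGen_mul_self])
      (fun i j h => by
        ext x
        simp [mulCliffordGen, ← mul_assoc, cliffordGen_mul_comm h])

theorem of_z_ne_one : (PresentedGroup.of HGen.z : HTilde n) ≠ 1 := by
  intro h
  have h' : cliffordRep n (PresentedGroup.of HGen.z) = -1 := PresentedGroup.toGroup.of _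
  rw [h, map_one] at h'
  have h1 := congrArg (fun u : (Module.End ℚ (CliffordAlgebra (negSumSquares n)))ˣ => u.val 1) h'
  have h2 : (1 : CliffordAlgebra (negSumSquares n)) = -1 := by simpa using h1
  have : Invertible (2 : ℚ) := invertibleOfNonzero two_ne_zero
  have : CharZero (CliffordAlgebra (negSumSquares n)) := algebraRat.charZero _
  exact two_ne_zero (one_add_one_eq_two.symm.trans (eq_neg_iff_add_eq_zero.1 h2))

/-- The hyperoctahedral group `{±1}ⁿ ⋊ Sₙ`. -/
abbrev Hyperoctahedral (n : ℕ) :=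
  (Fin n → Multiplicative (ZMod 2)) ⋊[mulAutArrow] Equiv.Perm (Fin n)

theorem mulSingle_sq (j : Fin n) :
    (Pi.mulSingle j (Multiplicative.ofAdd 1) : Fin n → Multiplicative (ZMod 2)) ^ 2 = 1 := by
  rw [← Pi.mulSingle_pow, show (Multiplicative.ofAdd (1 : ZMod 2)) ^ 2 = 1 from rfl,
    Pi.mulSingle_one]

/-- The projection of `H̃ₙ` onto the hyperoctahedral group. -/
def toHyperoctahedral (n : ℕ) : HTilde n →* Hyperoctahedral n :=
  PresentedGroup.toGroup (f := genImage SemidirectProduct.inr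
      (fun j => SemidirectProduct.inl (Pi.mulSingle j (Multiplicative.ofAdd 1))) 1) <|
    lift_genImage_eq_one _ _ _
      (fun σ j => by
        rw [← map_inv, ← SemidirectProduct.inl_aut]
        congr 1
        funext i
        change (Pi.mulSingle j (Multiplicative.ofAdd 1) : Fin n → Multiplicative (ZMod 2)) (σ⁻¹ i) = _
        simp [Pi.mulSingle_apply, Equiv.symm_apply_eq, Equiv.Perm.inv_def])
      (fun _ => Commute.one_left _) (fun _ => Commute.one_left _) (one_pow _)
      (fun j => by rw [← map_pow, mulSingle_sq, map_one])
      (fun i j _ => by rw [one_mul, ← map_mul, ← map_mul, mul_comm])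

theorem toHyperoctahedral_surjective (hn : 1 ≤ n) :
    Function.Surjective (toHyperoctahedral n) := by
  rw [← MonoidHom.range_eq_top, eq_top_iff]
  have hr : ∀ σ, (SemidirectProduct.inr σ : Hyperoctahedral n) ∈ (toHyperoctahedral n).range := by
    obtain ⟨m, rfl⟩ : ∃ m, n = m + 1 := ⟨n - 1, by omega⟩
    suffices h : Submonoid.closure (Set.range fun i : Fin m => Equiv.swap i.castSucc i.succ) ≤
        ((toHyperoctahedral (m + 1)).range.comap SemidirectProduct.inr).toSubmonoid from
      fun σ => h (by rw [Equiv.Perm.mclosure_swap_castSucc_succ]; trivial)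
    rw [Submonoid.closure_le]
    rintro _ ⟨i, rfl⟩
    exact ⟨PresentedGroup.of (HGen.s i), PresentedGroup.toGroup.of _⟩
  have hl : ∀ v, (SemidirectProduct.inl v : Hyperoctahedral n) ∈ (toHyperoctahedral n).range := by
    intro v
    rw [← Finset.univ_prod_mulSingle v]
    refine Subgroup.mem_comap.1 (prod_mem fun j _ => ?_)
    have hj : v j = 1 ∨ v j = Multiplicative.ofAdd 1 := by
      generalize v j = x
      revert x
      decide
    rcases hj with hj | hj
    · simp [hj]
    · rw [hj]
      exact ⟨PresentedGroup.of (HGen.a j), PresentedGroup.toGroup.of _⟩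
  intro g _
  rw [← SemidirectProduct.inl_left_mul_inr_right g]
  exact mul_mem (hl _) (hr _)

theorem card_hyperoctahedral : Nat.card (Hyperoctahedral n) = 2 ^ n * n.factorial := by
  rw [SemidirectProduct.card]
  simp [Fintype.card_perm]

end Models

section Relations

theorem of_z_sq : (PresentedGroup.of HGen.z : HTilde n) ^ 2 = 1 :=
  PresentedGroup.one_of_mem (rels := hRels n) (x := Z ^ 2) (by simp [hRels])

theorem commute_of_z (x : HTilde n) : Commute (PresentedGroup.of HGen.z) x := by
  suffices h : x ∈ Subgroup.centralizer {(PresentedGroup.of HGen.z : HTilde n)} from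
    Subgroup.mem_centralizer_iff.1 h _ rfl
  refine PresentedGroup.generated_by _ _ (fun g => ?_) x
  rw [Subgroup.mem_centralizer_singleton_iff]
  cases g with
  | s i =>
    exact (mul_inv_eq_iff_eq_mul.1 (mul_inv_eq_one.1 (PresentedGroup.one_of_mem (rels := hRels n)
      (x := Z * S i * Z⁻¹ * (S i)⁻¹) (Or.inl ⟨i, rfl⟩)))).symm
  | a j =>
    exact (mul_inv_eq_iff_eq_mul.1 (mul_inv_eq_one.1 (PresentedGroup.one_of_mem (rels := hRels n)
      (x := Z * A j * Z⁻¹ * (A j)⁻¹) (Or.inr (Or.inl ⟨j, rfl⟩))))).symm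
  | z => rfl

theorem of_s_mul_self (i : Fin (n - 1)) :
    (PresentedGroup.of (HGen.s i) : HTilde n) * PresentedGroup.of (HGen.s i) = 1 := by
  rw [← pow_two]
  exact PresentedGroup.one_of_mem (rels := hRels n) (x := S i ^ 2)
    (Or.inr (Or.inr (Or.inr (Or.inl ⟨i, rfl⟩))))

theorem of_s_inv (i : Fin (n - 1)) :
    (PresentedGroup.of (HGen.s i) : HTilde n)⁻¹ = PresentedGroup.of (HGen.s i) :=
  inv_eq_of_mul_eq_one_right (of_s_mul_self i)

theorem of_s_braid {i j : Fin (n - 1)} (h : (j : ℕ) = i + 1) :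
    (PresentedGroup.of (HGen.s i) : HTilde n) * PresentedGroup.of (HGen.s j) *
        PresentedGroup.of (HGen.s i) =
      PresentedGroup.of (HGen.s j) * PresentedGroup.of (HGen.s i) *
        PresentedGroup.of (HGen.s j) := by
  have h3 : ((PresentedGroup.of (HGen.s i) : HTilde n) * PresentedGroup.of (HGen.s j)) ^ 3 = 1 :=
    PresentedGroup.one_of_mem (rels := hRels n) (x := (S i * S j) ^ 3)
      (Or.inr (Or.inr (Or.inr (Or.inr (Or.inl ⟨i, j, h, rfl⟩)))))
  rw [← mul_inv_eq_one]
  simpa [of_s_inv, pow_succ, mul_assoc] using h3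

theorem commute_of_s {i j : Fin (n - 1)} (h : (i : ℕ) + 1 < j) :
    Commute (PresentedGroup.of (HGen.s i) : HTilde n) (PresentedGroup.of (HGen.s j)) := by
  have h2 : ((PresentedGroup.of (HGen.s i) : HTilde n) * PresentedGroup.of (HGen.s j)) ^ 2 = 1 :=
    PresentedGroup.one_of_mem (rels := hRels n) (x := (S i * S j) ^ 2)
      (Or.inr (Or.inr (Or.inr (Or.inr (Or.inr (Or.inl ⟨i, j, Or.inl h, rfl⟩))))))
  rw [commute_iff_eq, ← mul_inv_eq_one]
  simpa [of_s_inv, pow_succ, mul_assoc] using h2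

theorem of_a_sq (j : Fin n) :
    (PresentedGroup.of (HGen.a j) : HTilde n) ^ 2 = PresentedGroup.of HGen.z :=
  mul_inv_eq_one.1 <| PresentedGroup.one_of_mem (rels := hRels n) (x := A j ^ 2 * Z⁻¹)
    (Or.inr (Or.inr (Or.inr (Or.inr (Or.inr (Or.inr (Or.inr (Or.inr (Or.inl ⟨j, rfl⟩)))))))))

theorem of_a_mul_of_a {i j : Fin n} (h : i ≠ j) :
    (PresentedGroup.of (HGen.a i) : HTilde n) * PresentedGroup.of (HGen.a j) =
      PresentedGroup.of HGen.z *
        (PresentedGroup.of (HGen.a j) * PresentedGroup.of (HGen.a i)) := by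
  rw [← mul_assoc, ← mul_inv_eq_iff_eq_mul, ← mul_inv_eq_iff_eq_mul]
  exact mul_inv_eq_one.1 <| PresentedGroup.one_of_mem (rels := hRels n)
    (x := A i * A j * (A i)⁻¹ * (A j)⁻¹ * Z⁻¹)
    (Or.inr (Or.inr (Or.inr (Or.inr (Or.inr (Or.inr (Or.inr (Or.inr (Or.inr ⟨i, j, h, rfl⟩)))))))))

theorem of_s_conj_of_a (i : Fin (n - 1)) (j : Fin n) :
    ∃ k : Fin n, (PresentedGroup.of (HGen.s i) : HTilde n) * PresentedGroup.of (HGen.a j) *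
      (PresentedGroup.of (HGen.s i))⁻¹ = PresentedGroup.of (HGen.a k) := by
  have h : (PresentedGroup.of (HGen.s i) : HTilde n) * PresentedGroup.of (HGen.a (idx1 i)) *
      (PresentedGroup.of (HGen.s i))⁻¹ = PresentedGroup.of (HGen.a (idx2 i)) :=
    mul_inv_eq_one.1 <| PresentedGroup.one_of_mem (rels := hRels n)
      (x := S i * A (idx1 i) * (S i)⁻¹ * (A (idx2 i))⁻¹)
      (Or.inr (Or.inr (Or.inr (Or.inr (Or.inr (Or.inr (Or.inl ⟨i, rfl⟩)))))))
  by_cases h1 : (j : ℕ) = i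
  · obtain rfl : j = idx1 i := Fin.ext h1
    exact ⟨_, h⟩
  by_cases h2 : (j : ℕ) = i + 1
  · obtain rfl : j = idx2 i := Fin.ext h2
    refine ⟨idx1 i, ?_⟩
    rw [← h, of_s_inv]
    simp only [mul_assoc, of_s_mul_self, mul_one]
    rw [← mul_assoc, of_s_mul_self, one_mul]
  · exact ⟨j, mul_inv_eq_one.1 <| PresentedGroup.one_of_mem (rels := hRels n)
      (x := S i * A j * (S i)⁻¹ * (A j)⁻¹)
      (Or.inr (Or.inr (Or.inr (Or.inr (Or.inr (Or.inr (Or.inr (Or.inl ⟨i, j, h1, h2, rfl⟩))))))))⟩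

/-- The subgroup of `H̃ₙ` generated by `z` and the `aⱼ`. -/
def cliffordSubgroup (n : ℕ) : Subgroup (HTilde n) :=
  Subgroup.closure (insert (PresentedGroup.of HGen.z)
    ((fun j : Fin n => PresentedGroup.of (HGen.a j)) '' {j | (j : ℕ) < n}))

theorem of_z_mem : (PresentedGroup.of HGen.z : HTilde n) ∈ cliffordSubgroup n :=
  Subgroup.subset_closure (Set.mem_insert _ _)

theorem of_a_mem (j : Fin n) : (PresentedGroup.of (HGen.a j) : HTilde n) ∈ cliffordSubgroup n :=
  Subgroup.subset_closure (Set.mem_insert_of_mem _ ⟨j, j.isLt, rfl⟩)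

theorem finite_cliffordSubgroup_and_card_le (n : ℕ) :
    Finite (cliffordSubgroup n) ∧ Nat.card (cliffordSubgroup n) ≤ 2 ^ (n + 1) :=
  finite_closure_insert_and_card_le _ _ (fun _ => commute_of_z _) of_z_sq of_a_sq
    (fun _ _ h => of_a_mul_of_a h) n le_rfl

instance : (cliffordSubgroup n).Normal := by
  rw [← Subgroup.normalizer_eq_top_iff, eq_top_iff]
  intro x _
  refine PresentedGroup.generated_by _ _ (fun g => ?_) x
  cases g with
  | s i =>
    have hle : cliffordSubgroup n ≤ (cliffordSubgroup n).comap
        (MulAut.conj (PresentedGroup.of (HGen.s i))).toMonoidHom := by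
      refine (Subgroup.closure_le _).2 ?_
      rintro _ (rfl | ⟨j, -, rfl⟩)
      · simpa [← (commute_of_z _).eq] using of_z_mem
      · obtain ⟨k, hk⟩ := of_s_conj_of_a i j
        simpa [hk] using of_a_mem k
    refine Subgroup.mem_normalizer_iff.2 fun y => ⟨fun hy => hle hy, fun hy => ?_⟩
    have h : PresentedGroup.of (HGen.s i) * (PresentedGroup.of (HGen.s i) * y *
        (PresentedGroup.of (HGen.s i))⁻¹) * (PresentedGroup.of (HGen.s i))⁻¹ ∈
          cliffordSubgroup n := hle hy
    rw [of_s_inv] at h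
    simp only [mul_assoc, of_s_mul_self, mul_one] at h
    rwa [← mul_assoc, of_s_mul_self, one_mul] at h
  | a j => exact Subgroup.le_normalizer (of_a_mem j)
  | z => exact Subgroup.le_normalizer of_z_mem

theorem finite_and_card_le (hn : 1 ≤ n) :
    Finite (HTilde n) ∧ Nat.card (HTilde n) ≤ 2 ^ (n + 1) * n.factorial := by
  obtain ⟨_, hcard⟩ := finite_cliffordSubgroup_and_card_le n
  let s : ℕ → HTilde n := fun i =>
    if h : i < n - 1 then PresentedGroup.of (HGen.s ⟨i, h⟩) else 1
  have hs : ∀ i (h : i < n - 1), s i = PresentedGroup.of (HGen.s ⟨i, h⟩) := fun i h => dif_pos h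
  have key := finite_closure_union_and_card_le (cliffordSubgroup n) (s := s) (m := n - 1)
    (fun i hi => by rw [hs i hi, of_s_mul_self])
    (fun i hi => by rw [hs i (by omega), hs (i + 1) hi, of_s_braid rfl])
    (fun i j hij hj => by
      rw [hs i (by omega), hs j hj]
      exact commute_of_s hij) (n - 1) le_rfl
  have htop : Subgroup.closure ((cliffordSubgroup n : Set (HTilde n)) ∪ s '' Set.Iio (n - 1)) =
      ⊤ := by
    rw [eq_top_iff]
    intro x _
    refine PresentedGroup.generated_by _ _ (fun g => Subgroup.subset_closure ?_) x
    cases g with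
    | s i => exact Or.inr ⟨i, i.isLt, hs i i.isLt⟩
    | a j => exact Or.inl (of_a_mem j)
    | z => exact Or.inl of_z_mem
  rw [htop, Nat.sub_add_cancel hn, Subgroup.card_top] at key
  obtain ⟨hfin, hle⟩ := key
  refine ⟨Finite.of_equiv _ Subgroup.topEquiv.toEquiv, hle.trans ?_⟩
  rw [mul_comm]
  gcongr

theorem le_card (hn : 1 ≤ n) [Finite (HTilde n)] :
    2 ^ (n + 1) * n.factorial ≤ Nat.card (HTilde n) := by
  have hker : Subgroup.zpowers (PresentedGroup.of HGen.z) ≤ (toHyperoctahedral n).ker := by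
    rw [Subgroup.zpowers_le, MonoidHom.mem_ker]
    exact PresentedGroup.toGroup.of _
  have h2 : 2 ≤ Nat.card (toHyperoctahedral n).ker := by
    have := Subgroup.card_le_of_le hker
    rwa [Nat.card_zpowers, orderOf_eq_prime of_z_sq of_z_ne_one] at this
  have hindex : (toHyperoctahedral n).ker.index = 2 ^ n * n.factorial := by
    rw [Subgroup.index_ker, MonoidHom.range_eq_top.2 (toHyperoctahedral_surjective hn),
      Subgroup.card_top, card_hyperoctahedral]
  rw [← Subgroup.card_mul_index (toHyperoctahedral n).ker, hindex, pow_succ', mul_assoc]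
  gcongr

end Relations

/-- for `n ≥ 1`, the twisted hyperoctahedral group `H̃ₙ` is a
finite group of order `2^(n+1) * n!`. -/
theorem htilde_finite_card (n : ℕ) (hn : 1 ≤ n) :
    Finite (HTilde n) ∧ Nat.card (HTilde n) = 2 ^ (n + 1) * n.factorial := by
  obtain ⟨_, hle⟩ := finite_and_card_le hn
  exact ⟨‹_›, hle.antisymm (le_card hn)⟩

end SpinHyperoctahedral
end

section
/- Let n ≥ 2. In the twisted hyperoctahedral group H̃_n, let A be the subgroup generated by a_1,…,a_n and let S be the subgroup generated by s_1,…,s_{n−1}. Then A is a normal subgroup of H̃_n of order 2^{n+1}, S has order n!, A ∩ S is trivial, and A and S together generate H̃_n (so H̃_n is the internal semidirect product of A by S). -/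
/-!
STATEMENT 2: for `n ≥ 2`, inside the twisted hyperoctahedral group `H̃ₙ`, the
subgroup `A` generated by `a₁, …, aₙ` is normal of order `2^(n+1)`, the
subgroup `S` generated by `s₁, …, s_{n−1}` has order `n!`, `A ∩ S` is trivial,
and `A` and `S` together generate `H̃ₙ` (internal semidirect product).
-/

namespace SpinHyperoctahedralStmt2

inductive HGen (n : ℕ) : Type
  | s : Fin (n - 1) → HGen n
  | a : Fin n → HGen n
  | z : HGen n

variable {n : ℕ}

def S (i : Fin (n - 1)) : FreeGroup (HGen n) := FreeGroup.of (HGen.s i)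
def A (j : Fin n) : FreeGroup (HGen n) := FreeGroup.of (HGen.a j)
def Z : FreeGroup (HGen n) := FreeGroup.of (HGen.z)

def idx1 (i : Fin (n - 1)) : Fin n := ⟨(i : ℕ), by have := i.isLt; omega⟩
def idx2 (i : Fin (n - 1)) : Fin n := ⟨(i : ℕ) + 1, by have := i.isLt; omega⟩

def hRels (n : ℕ) : Set (FreeGroup (HGen n)) :=
  { w | (∃ i : Fin (n - 1), w = Z * S i * Z⁻¹ * (S i)⁻¹)
    ∨ (∃ j : Fin n, w = Z * A j * Z⁻¹ * (A j)⁻¹)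
    ∨ (w = Z ^ 2)
    ∨ (∃ i : Fin (n - 1), w = S i ^ 2)
    ∨ (∃ i j : Fin (n - 1), (j : ℕ) = (i : ℕ) + 1 ∧ w = (S i * S j) ^ 3)
    ∨ (∃ i j : Fin (n - 1), ((i : ℕ) + 2 ≤ (j : ℕ) ∨ (j : ℕ) + 2 ≤ (i : ℕ)) ∧
        w = (S i * S j) ^ 2)
    ∨ (∃ i : Fin (n - 1), w = S i * A (idx1 i) * (S i)⁻¹ * (A (idx2 i))⁻¹)
    ∨ (∃ (i : Fin (n - 1)) (j : Fin n), (j : ℕ) ≠ (i : ℕ) ∧ (j : ℕ) ≠ (i : ℕ) + 1 ∧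
        w = S i * A j * (S i)⁻¹ * (A j)⁻¹)
    ∨ (∃ j : Fin n, w = A j ^ 2 * Z⁻¹)
    ∨ (∃ i j : Fin n, i ≠ j ∧ w = A i * A j * (A i)⁻¹ * (A j)⁻¹ * Z⁻¹) }

abbrev HTilde (n : ℕ) := PresentedGroup (hRels n)

section CosetBound

open scoped Pointwise

variable {G : Type*} [Group G]

/-- If the generators of a subgroup permute finitely many left cosets `r i * H`, one of which is
`H` itself, then the subgroup is contained in the union of these cosets. -/
theorem card_closure_le_mul (X : Set G) (H : Subgroup G) [Finite H] {m : ℕ} (r : Fin m → G)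
    (h1 : ∃ i, r i = 1) (hX : ∀ x ∈ X, ∀ i, ∃ j, ∃ h ∈ H, x * r i = r j * h) :
    Finite (Subgroup.closure X) ∧ Nat.card (Subgroup.closure X) ≤ m * Nat.card H := by
  let f : Fin m × H → G := fun p => r p.1 * p.2
  have hle : Subgroup.closure X ≤ MulAction.stabilizer G (Set.range f) := by
    rw [Subgroup.closure_le]
    intro x hx
    rw [SetLike.mem_coe, MulAction.mem_stabilizer_set_iff_smul_set_subset (Set.finite_range f)]
    rintro _ ⟨_, ⟨⟨i, h⟩, rfl⟩, rfl⟩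
    obtain ⟨j, h', hh', e⟩ := hX x hx i
    exact ⟨(j, ⟨h', hh'⟩ * h), by simp [f, ← mul_assoc, e]⟩
  have hmem : ∀ g : Subgroup.closure X, ∃ p, f p = g := by
    intro g
    have hg := hle g.2
    rw [MulAction.mem_stabilizer_iff] at hg
    have h1' : (1 : G) ∈ Set.range f := by
      obtain ⟨i, hi⟩ := h1
      exact ⟨(i, 1), by simp [f, hi]⟩
    have := Set.smul_mem_smul_set (a := (g : G)) h1'
    rwa [hg, smul_eq_mul, mul_one] at this
  choose p hp using hmem
  have hinj : Function.Injective p := fun a b hab => Subtype.ext (by rw [← hp a, ← hp b, hab])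
  refine ⟨Finite.of_injective p hinj, (Nat.card_le_card_of_injective p hinj).trans ?_⟩
  simp [Nat.card_prod]

/-- The ascending product `s j * s (j + 1) * ⋯ * s (j + d - 1)`. -/
def ascProd (s : ℕ → G) : ℕ → ℕ → G
  | _, 0 => 1
  | j, d + 1 => s j * ascProd s (j + 1) d

theorem mul_ascProd_of_add_two_le {s : ℕ → G} (hc : ∀ i j, i + 2 ≤ j → s i * s j = s j * s i)
    {i : ℕ} (d : ℕ) : ∀ j, i + 2 ≤ j → s i * ascProd s j d = ascProd s j d * s i := by
  induction d with
  | zero => intro j _; simp [ascProd]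
  | succ d ih =>
    intro j hj
    rw [ascProd, ← mul_assoc, hc i j hj, mul_assoc, ih (j + 1) (by omega), mul_assoc]

theorem mul_ascProd_of_lt {s : ℕ → G} {m : ℕ}
    (hb : ∀ i, i + 1 < m → s (i + 1) * s i * s (i + 1) = s i * s (i + 1) * s i)
    (hc : ∀ i j, i + 2 ≤ j → s i * s j = s j * s i) {i : ℕ} (hi : i + 1 < m) (d : ℕ) :
    ∀ j, j ≤ i → i + 1 < j + d → s (i + 1) * ascProd s j d = ascProd s j d * s i := by
  induction d with
  | zero => intro j _ _; omega
  | succ d ih =>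
    intro j hj hd
    rcases hj.lt_or_eq with hlt | rfl
    · rw [ascProd, ← mul_assoc, ← hc j (i + 1) (by omega), mul_assoc,
        ih (j + 1) (by omega) (by omega), mul_assoc]
    · obtain ⟨d, rfl⟩ : ∃ e, d = e + 1 := ⟨d - 1, by omega⟩
      rw [ascProd, ascProd, ← mul_assoc, ← mul_assoc, hb j hi, mul_assoc _ (s j),
        mul_ascProd_of_add_two_le hc d _ (by omega)]
      simp only [mul_assoc]

/-- A group generated by `k` elements satisfying the Coxeter relations of type `A` has order at
most `(k + 1)!`. -/
theorem card_closure_le_factorial {s : ℕ → G} {m : ℕ} (hs : ∀ i, s i * s i = 1)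
    (hb : ∀ i, i + 1 < m → s (i + 1) * s i * s (i + 1) = s i * s (i + 1) * s i)
    (hc : ∀ i j, i + 2 ≤ j → s i * s j = s j * s i) (k : ℕ) (hk : k ≤ m) :
    Finite (Subgroup.closure (s '' Set.Iio k)) ∧
      Nat.card (Subgroup.closure (s '' Set.Iio k)) ≤ (k + 1).factorial := by
  induction k with
  | zero =>
    rw [show Set.Iio 0 = (∅ : Set ℕ) by ext; simp, Set.image_empty, Subgroup.closure_empty]
    exact ⟨inferInstance, by simp⟩
  | succ k ih =>
    obtain ⟨hfin, hcard⟩ := ih (by omega)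
    have hmem : ∀ i, i < k → s i ∈ Subgroup.closure (s '' Set.Iio k) := fun i hi =>
      Subgroup.subset_closure ⟨i, hi, rfl⟩
    obtain ⟨hfin', hcard'⟩ := card_closure_le_mul (s '' Set.Iio (k + 1))
      (Subgroup.closure (s '' Set.Iio k)) (fun j : Fin (k + 2) => ascProd s j (k + 1 - j))
      ⟨Fin.last _, by simp [ascProd]⟩ (by
        rintro _ ⟨i, hi, rfl⟩ ⟨j, hj⟩
        have hi : i < k + 1 := hi
        dsimp only
        rcases lt_trichotomy i j with hij | rfl | hij
        · by_cases h : i + 2 ≤ j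
          · exact ⟨⟨j, hj⟩, s i, hmem i (by omega), mul_ascProd_of_add_two_le hc _ _ h⟩
          · obtain rfl : j = i + 1 := by omega
            refine ⟨⟨i, by omega⟩, 1, one_mem _, ?_⟩
            rw [mul_one, show k + 1 - i = (k + 1 - (i + 1)) + 1 by omega, ascProd]
        · refine ⟨⟨i + 1, by omega⟩, 1, one_mem _, ?_⟩
          rw [show k + 1 - i = (k + 1 - (i + 1)) + 1 by omega, ascProd, ← mul_assoc, hs,
            one_mul, mul_one]
        · obtain ⟨i, rfl⟩ : ∃ e, i = e + 1 := ⟨i - 1, by omega⟩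
          exact ⟨⟨j, hj⟩, s i, hmem i (by omega),
            mul_ascProd_of_lt hb hc (by omega) _ _ (by omega) (by omega)⟩)
    refine ⟨hfin', hcard'.trans ?_⟩
    rw [Nat.factorial_succ (k + 1)]
    exact Nat.mul_le_mul_left _ hcard

/-- Pairwise commuting up to a central involution `z`, with squares equal to `z`, `k` elements
generate together with `z` a group of order at most `2 ^ (k + 1)`. -/
theorem card_closure_le_two_pow {a : Fin n → G} {z : G} (hz : z * z = 1)
    (ha : ∀ j, a j * a j = z) (haa : ∀ i j, i ≠ j → a i * a j = z * (a j * a i))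
    (k : ℕ) (hk : k ≤ n) :
    Finite (Subgroup.closure (insert z (a '' {j | (j : ℕ) < k}))) ∧
      Nat.card (Subgroup.closure (insert z (a '' {j | (j : ℕ) < k}))) ≤ 2 ^ (k + 1) := by
  have hza : ∀ j, z * a j = a j * z := fun j => by rw [← ha j, mul_assoc]
  induction k with
  | zero =>
    obtain ⟨h1, h2⟩ := card_closure_le_mul {z} (⊥ : Subgroup G) ![1, z] ⟨0, rfl⟩ (by
      rintro _ rfl i
      fin_cases i
      · exact ⟨1, 1, one_mem _, by simp⟩
      · exact ⟨0, 1, one_mem _, by simp [hz]⟩)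
    simpa using And.intro h1 h2
  | succ k ih =>
    obtain ⟨hfin, hcard⟩ := ih (by omega)
    have hzmem : z ∈ Subgroup.closure (insert z (a '' {j | (j : ℕ) < k})) :=
      Subgroup.subset_closure (Set.mem_insert _ _)
    obtain ⟨hfin', hcard'⟩ := card_closure_le_mul (insert z (a '' {j | (j : ℕ) < k + 1}))
      (Subgroup.closure (insert z (a '' {j | (j : ℕ) < k}))) ![1, a ⟨k, by omega⟩] ⟨0, rfl⟩ (by
        rintro _ (rfl | ⟨j, hj, rfl⟩) i
        · refine ⟨i, _, hzmem, ?_⟩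
          fin_cases i
          · simp
          · exact hza _
        · by_cases hjk : (j : ℕ) = k
          · obtain rfl : k = j := hjk.symm
            fin_cases i
            · exact ⟨1, 1, one_mem _, by simp⟩
            · exact ⟨0, z, hzmem, by simp [ha]⟩
          · have hj : (j : ℕ) < k + 1 := hj
            have hmem : a j ∈ Subgroup.closure (insert z (a '' {j | (j : ℕ) < k})) :=
              Subgroup.subset_closure (Set.mem_insert_of_mem _ ⟨j, by simp; omega, rfl⟩)
            fin_cases i
            · exact ⟨0, a j, hmem, by simp⟩
            · refine ⟨1, z * a j, mul_mem hzmem hmem, ?_⟩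
              have hne : j ≠ ⟨k, by omega⟩ := fun h => hjk (congrArg Fin.val h)
              simp only [Fin.mk_one, Matrix.cons_val_one, Matrix.cons_val_fin_one]
              rw [haa _ _ hne, ← mul_assoc, hza, mul_assoc])
    refine ⟨hfin', hcard'.trans ?_⟩
    rw [pow_succ' 2 (k + 1)]
    exact Nat.mul_le_mul_left _ hcard

end CosetBound

namespace HTilde

def s (i : Fin (n - 1)) : HTilde n := PresentedGroup.of (HGen.s i)
def a (j : Fin n) : HTilde n := PresentedGroup.of (HGen.a j)
def z : HTilde n := PresentedGroup.of HGen.z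

theorem z_mul_z : (z : HTilde n) * z = 1 := by
  have h : PresentedGroup.mk (hRels n) (Z ^ 2) = 1 :=
    PresentedGroup.one_of_mem (Or.inr <| Or.inr <| Or.inl rfl)
  rw [pow_two, map_mul] at h
  exact h

theorem z_mul_s (i : Fin (n - 1)) : z * s i = s i * z := by
  have h : PresentedGroup.mk (hRels n) (Z * S i * Z⁻¹ * (S i)⁻¹) = 1 :=
    PresentedGroup.one_of_mem (Or.inl ⟨i, rfl⟩)
  simp only [map_mul, map_inv] at h
  exact mul_inv_eq_iff_eq_mul.mp (mul_inv_eq_one.mp h)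

theorem s_mul_s (i : Fin (n - 1)) : s i * s i = 1 := by
  have h : PresentedGroup.mk (hRels n) (S i ^ 2) = 1 :=
    PresentedGroup.one_of_mem (Or.inr <| Or.inr <| Or.inr <| Or.inl ⟨i, rfl⟩)
  rw [pow_two, map_mul] at h
  exact h

theorem s_inv (i : Fin (n - 1)) : (s i)⁻¹ = s i := inv_eq_of_mul_eq_one_left (s_mul_s i)

theorem s_braid {i j : Fin (n - 1)} (hij : (j : ℕ) = i + 1) :
    s j * s i * s j = s i * s j * s i := by
  have h : PresentedGroup.mk (hRels n) ((S i * S j) ^ 3) = 1 :=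
    PresentedGroup.one_of_mem
      (Or.inr <| Or.inr <| Or.inr <| Or.inr <| Or.inl ⟨i, j, hij, rfl⟩)
  rw [map_pow, map_mul] at h
  change (s i * s j) ^ 3 = 1 at h
  have h' : (s i * s j * s i) * (s j * s i * s j) = 1 := by
    rw [← h]; simp only [pow_succ, pow_zero, one_mul, mul_assoc]
  rw [eq_inv_of_mul_eq_one_right h']
  simp [s_inv, mul_assoc]

theorem s_comm {i j : Fin (n - 1)} (hij : (i : ℕ) + 2 ≤ j) : s i * s j = s j * s i := by
  have h : PresentedGroup.mk (hRels n) ((S i * S j) ^ 2) = 1 :=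
    PresentedGroup.one_of_mem
      (Or.inr <| Or.inr <| Or.inr <| Or.inr <| Or.inr <| Or.inl ⟨i, j, Or.inl hij, rfl⟩)
  rw [map_pow, map_mul, pow_two] at h
  change (s i * s j) * (s i * s j) = 1 at h
  rw [eq_inv_of_mul_eq_one_right h, mul_inv_rev, s_inv, s_inv]

theorem a_mul_a (j : Fin n) : a j * a j = z := by
  have h : PresentedGroup.mk (hRels n) (A j ^ 2 * Z⁻¹) = 1 :=
    PresentedGroup.one_of_mem (Or.inr <| Or.inr <| Or.inr <| Or.inr <| Or.inr <| Or.inr <|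
      Or.inr <| Or.inr <| Or.inl ⟨j, rfl⟩)
  rw [map_mul, map_inv, pow_two, map_mul] at h
  exact mul_inv_eq_one.mp h

theorem a_mul_a_of_ne (i j : Fin n) (hij : i ≠ j) : a i * a j = z * (a j * a i) := by
  have h : PresentedGroup.mk (hRels n) (A i * A j * (A i)⁻¹ * (A j)⁻¹ * Z⁻¹) = 1 :=
    PresentedGroup.one_of_mem (Or.inr <| Or.inr <| Or.inr <| Or.inr <| Or.inr <| Or.inr <|
      Or.inr <| Or.inr <| Or.inr ⟨i, j, hij, rfl⟩)
  simp only [map_mul, map_inv] at h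
  have h' := mul_inv_eq_iff_eq_mul.mp (mul_inv_eq_iff_eq_mul.mp (mul_inv_eq_one.mp h))
  rw [mul_assoc] at h'
  exact h'

theorem s_mul_a_idx1 (i : Fin (n - 1)) : s i * a (idx1 i) * (s i)⁻¹ = a (idx2 i) := by
  have h : PresentedGroup.mk (hRels n) (S i * A (idx1 i) * (S i)⁻¹ * (A (idx2 i))⁻¹) = 1 :=
    PresentedGroup.one_of_mem (Or.inr <| Or.inr <| Or.inr <| Or.inr <| Or.inr <| Or.inr <|
      Or.inl ⟨i, rfl⟩)
  simp only [map_mul, map_inv] at h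
  exact mul_inv_eq_one.mp h

theorem s_mul_a_mul_s_inv (i : Fin (n - 1)) (j : Fin n) :
    s i * a j * (s i)⁻¹ = a (Equiv.swap (idx1 i) (idx2 i) j) := by
  by_cases h1 : j = idx1 i
  · rw [h1, Equiv.swap_apply_left, s_mul_a_idx1]
  by_cases h2 : j = idx2 i
  · rw [h2, Equiv.swap_apply_right, ← s_mul_a_idx1, ← mul_assoc, ← mul_assoc, s_mul_s, one_mul,
      mul_assoc, ← mul_inv_rev, s_mul_s, inv_one, mul_one]
  · have h : PresentedGroup.mk (hRels n) (S i * A j * (S i)⁻¹ * (A j)⁻¹) = 1 :=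
      PresentedGroup.one_of_mem (Or.inr <| Or.inr <| Or.inr <| Or.inr <| Or.inr <| Or.inr <|
        Or.inr <| Or.inl ⟨i, j, fun e => h1 (Fin.ext e), fun e => h2 (Fin.ext e), rfl⟩)
    simp only [map_mul, map_inv] at h
    rw [Equiv.swap_apply_of_ne_of_ne h1 h2]
    exact mul_inv_eq_one.mp h

theorem idx1_ne_idx2 (i : Fin (n - 1)) : idx1 i ≠ idx2 i := by simp [idx1, idx2]

theorem swap_pow_three (i j : Fin (n - 1)) (hij : (j : ℕ) = i + 1) :
    (Equiv.swap (idx1 i) (idx2 i) * Equiv.swap (idx1 j) (idx2 j)) ^ 3 = 1 := by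
  have e : idx1 j = idx2 i := Fin.ext hij
  have h : idx1 i ≠ idx2 j := by simp [idx1, idx2]; omega
  have := (Equiv.Perm.isThreeCycle_swap_mul_swap_same (a := idx2 i) (b := idx1 i) (c := idx2 j)
    (idx1_ne_idx2 i).symm (e ▸ idx1_ne_idx2 j) h).orderOf
  rw [e, Equiv.swap_comm (idx1 i), ← this, pow_orderOf_eq_one]

theorem swap_mul_swap_pow_two (i j : Fin (n - 1))
    (hij : (i : ℕ) + 2 ≤ j ∨ (j : ℕ) + 2 ≤ i) :
    (Equiv.swap (idx1 i) (idx2 i) * Equiv.swap (idx1 j) (idx2 j)) ^ 2 = 1 := by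
  have hd : Equiv.Perm.Disjoint (Equiv.swap (idx1 i) (idx2 i)) (Equiv.swap (idx1 j) (idx2 j)) := by
    intro k
    by_cases h : (k : ℕ) = i ∨ (k : ℕ) = i + 1
    · right
      apply Equiv.swap_apply_of_ne_of_ne <;> simp [idx1, idx2, Fin.ext_iff] <;> omega
    · left
      apply Equiv.swap_apply_of_ne_of_ne <;> simp [idx1, idx2, Fin.ext_iff] <;> omega
  rw [hd.commute.mul_pow, pow_two, pow_two, Equiv.swap_mul_self, Equiv.swap_mul_self, one_mul]

variable {G : Type*} [Group G]

/-- The images of the generators determined by a homomorphism from the symmetric group and by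
images of the `a j` and of `z`. -/
def genMap (P : Equiv.Perm (Fin n) →* G) (b : Fin n → G) (c : G) : HGen n → G
  | .s i => P (Equiv.swap (idx1 i) (idx2 i))
  | .a j => b j
  | .z => c

theorem exists_hom (P : Equiv.Perm (Fin n) →* G) (b : Fin n → G) (c : G) (hc : c * c = 1)
    (hcP : ∀ σ, c * P σ = P σ * c) (hb : ∀ j, b j * b j = c)
    (hbb : ∀ i j, i ≠ j → b i * b j = c * (b j * b i))
    (hPb : ∀ σ j, P σ * b j = b (σ j) * P σ) :
    ∃ f : HTilde n →* G, (∀ i, f (s i) = P (Equiv.swap (idx1 i) (idx2 i))) ∧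
      (∀ j, f (a j) = b j) ∧ f z = c := by
  have hrel : ∀ w ∈ hRels n, FreeGroup.lift (genMap P b c) w = 1 := by
    have hS : ∀ i, FreeGroup.lift (genMap P b c) (S i) = P (Equiv.swap (idx1 i) (idx2 i)) :=
      fun i => FreeGroup.lift_apply_of
    have hA : ∀ j, FreeGroup.lift (genMap P b c) (A j) = b j := fun j => FreeGroup.lift_apply_of
    have hZ : FreeGroup.lift (genMap P b c) Z = c := FreeGroup.lift_apply_of
    rintro w (⟨i, rfl⟩ | ⟨j, rfl⟩ | rfl | ⟨i, rfl⟩ | ⟨i, j, hij, rfl⟩ | ⟨i, j, hij, rfl⟩ |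
      ⟨i, rfl⟩ | ⟨i, j, h1, h2, rfl⟩ | ⟨j, rfl⟩ | ⟨i, j, hij, rfl⟩) <;>
      simp only [map_mul, map_inv, map_pow, hS, hA, hZ]
    · rw [hcP]; simp
    · rw [← hb j]; group
    · rw [pow_two, hc]
    · rw [← map_pow, pow_two, Equiv.swap_mul_self, map_one]
    · rw [← map_mul, ← map_pow, swap_pow_three i j hij, map_one]
    · rw [← map_mul, ← map_pow, swap_mul_swap_pow_two i j hij, map_one]
    · rw [hPb, Equiv.swap_apply_left]; simp
    · rw [hPb, Equiv.swap_apply_of_ne_of_ne (fun e => h1 (congrArg Fin.val e))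
        (fun e => h2 (congrArg Fin.val e))]
      simp
    · rw [pow_two, hb, mul_inv_cancel]
    · rw [hbb i j hij]; group
  exact ⟨PresentedGroup.toGroup hrel, fun i => PresentedGroup.toGroup.of hrel,
    fun j => PresentedGroup.toGroup.of hrel, PresentedGroup.toGroup.of hrel⟩

theorem exists_hom_perm : ∃ f : HTilde n →* Equiv.Perm (Fin n),
    (∀ i, f (s i) = Equiv.swap (idx1 i) (idx2 i)) ∧ ∀ j, f (a j) = 1 := by
  obtain ⟨f, hs, ha, -⟩ := exists_hom (MonoidHom.id (Equiv.Perm (Fin n))) (fun _ => 1) 1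
    (by simp) (by simp) (by simp) (by simp) (by simp)
  exact ⟨f, hs, ha⟩

/-- Permutation of coordinates. -/
def permCoord (n : ℕ) (R : Type*) : Equiv.Perm (Fin n) →* Equiv.Perm (Fin n → R) where
  toFun σ := σ.arrowCongr (Equiv.refl R)
  map_one' := rfl
  map_mul' _ _ := rfl

theorem exists_hom_translation : ∃ f : HTilde n →* Equiv.Perm (Fin n → ZMod 2),
    (∀ j, f (a j) = Equiv.addLeft (Pi.single j 1)) ∧ f z = 1 := by
  have key := exists_hom (permCoord n (ZMod 2))
    (fun j => Equiv.addLeft (Pi.single j 1)) 1 (by simp) (by simp) ?_ ?_ ?_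
  · obtain ⟨f, -, ha, hz⟩ := key
    exact ⟨f, ha, hz⟩
  · intro j
    ext v k
    simp [← add_assoc, CharTwo.add_self_eq_zero]
  · intro i j _
    ext v k
    simp [add_left_comm]
  · intro σ j
    ext v k
    change (Pi.single j 1 : Fin n → ZMod 2) (σ.symm k) + v (σ.symm k) =
      (Pi.single (σ j) 1 : Fin n → ZMod 2) k + v (σ.symm k)
    simp [Pi.single_apply, Equiv.symm_apply_eq]

section Clifford

open CliffordAlgebra

/-- The negative definite form on `ℝⁿ`. -/
noncomputable abbrev negForm (n : ℕ) : QuadraticForm ℝ (Fin n → ℝ) :=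
  QuadraticMap.weightedSumSquares ℝ fun _ => (-1 : ℝ)

theorem negForm_single (j : Fin n) : negForm n (Pi.single j 1) = -1 := by
  simp [negForm, Pi.single_apply]

theorem isOrtho_single {i j : Fin n} (h : i ≠ j) :
    (negForm n).IsOrtho (Pi.single i 1) (Pi.single j 1) := by
  rw [QuadraticMap.isOrtho_def]
  simp [negForm, Pi.single_apply, mul_add, Finset.sum_add_distrib, h, h.symm]

/-- The isometry of the negative definite form permuting the coordinates. -/
noncomputable def permIsometry (σ : Equiv.Perm (Fin n)) : negForm n →qᵢ negForm n where
  toLinearMap := LinearMap.funLeft ℝ ℝ σ.symm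
  map_app' v := by
    simpa [LinearMap.funLeft_apply] using Equiv.sum_comp σ.symm fun i => v i * v i

theorem permIsometry_single (σ : Equiv.Perm (Fin n)) (j : Fin n) :
    permIsometry σ (Pi.single j 1) = Pi.single (σ j) 1 := by
  ext k
  change (Pi.single j 1 : Fin n → ℝ) (σ.symm k) = _
  simp [Pi.single_apply, Equiv.symm_apply_eq]

/-- The action of the symmetric group on the Clifford algebra. -/
noncomputable def permClifford (n : ℕ) :
    Equiv.Perm (Fin n) →* Equiv.Perm (CliffordAlgebra (negForm n)) :=
  MulAction.toPermHom _ _ |>.comp <| MonoidHom.toHomUnits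
    { toFun := fun σ => (map (permIsometry σ)).toLinearMap
      map_one' := by
        change (map (QuadraticMap.Isometry.id (negForm n))).toLinearMap = _
        rw [map_id]
        rfl
      map_mul' := fun σ τ => by
        change _ = ((map (permIsometry σ)).comp (map (permIsometry τ))).toLinearMap
        rw [map_comp_map]
        rfl }

theorem permClifford_apply (σ : Equiv.Perm (Fin n)) (x : CliffordAlgebra (negForm n)) :
    permClifford n σ x = map (permIsometry σ) x := rfl

theorem ι_mul_self (j : Fin n) :
    ι (negForm n) (Pi.single j 1) * ι (negForm n) (Pi.single j 1) = -1 := by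
  rw [ι_sq_scalar, negForm_single, map_neg, map_one]

/-- Left multiplication by a basis vector. -/
noncomputable def mulBasis (j : Fin n) : Equiv.Perm (CliffordAlgebra (negForm n)) where
  toFun x := ι (negForm n) (Pi.single j 1) * x
  invFun x := -(ι (negForm n) (Pi.single j 1) * x)
  left_inv x := by simp only [← mul_assoc, ι_mul_self, neg_mul, one_mul, neg_neg]
  right_inv x := by simp only [mul_neg, ← mul_assoc, ι_mul_self, neg_mul, one_mul, neg_neg]

theorem mulBasis_apply (j : Fin n) (x : CliffordAlgebra (negForm n)) :
    mulBasis j x = ι (negForm n) (Pi.single j 1) * x := rfl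

theorem z_ne_one : (z : HTilde n) ≠ 1 := by
  have key := exists_hom (permClifford n) mulBasis
    (Equiv.neg (CliffordAlgebra (negForm n))) ?_ ?_ ?_ ?_ ?_
  · obtain ⟨f, -, -, hz⟩ := key
    intro h
    rw [h, map_one] at hz
    have h1 : (1 : CliffordAlgebra (negForm n)) = -1 := Equiv.congr_fun hz 1
    have h2 : (2 : ℝ) • (1 : CliffordAlgebra (negForm n)) = 0 := by
      rw [two_smul]
      nth_rewrite 1 [h1]
      simp
    rcases smul_eq_zero.mp h2 with h | h
    · norm_num at h
    · exact one_ne_zero h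
  · ext x; simp
  · intro σ
    ext x
    simp [permClifford_apply]
  · intro j
    ext x
    rw [Equiv.Perm.mul_apply, mulBasis_apply, mulBasis_apply, ← mul_assoc, ι_mul_self, neg_one_mul]
    rfl
  · intro i j h
    ext x
    simp [mulBasis_apply, ← mul_assoc, ι_mul_ι_comm_of_isOrtho (isOrtho_single h)]
  · intro σ j
    ext x
    simp [mulBasis_apply, permClifford_apply, permIsometry_single]

end Clifford

theorem closure_a_sup_closure_s (hn : 1 ≤ n) :
    Subgroup.closure (Set.range (a : Fin n → HTilde n)) ⊔ Subgroup.closure (Set.range s) = ⊤ := by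
  rw [eq_top_iff, ← PresentedGroup.closure_range_of, Subgroup.closure_le]
  have ha : ∀ j, (a j : HTilde n) ∈
      Subgroup.closure (Set.range (a : Fin n → HTilde n)) ⊔ Subgroup.closure (Set.range s) :=
    fun j => Subgroup.mem_sup_left (Subgroup.subset_closure ⟨j, rfl⟩)
  rintro _ ⟨i | j | _, rfl⟩
  · exact Subgroup.mem_sup_right (Subgroup.subset_closure ⟨i, rfl⟩)
  · exact ha j
  · have := mul_mem (ha ⟨0, hn⟩) (ha ⟨0, hn⟩)
    rwa [a_mul_a] at this

theorem normal_closure_a (hn : 1 ≤ n) :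
    (Subgroup.closure (Set.range (a : Fin n → HTilde n))).Normal := by
  rw [← Subgroup.normalizer_eq_top_iff, eq_top_iff, ← closure_a_sup_closure_s hn, sup_le_iff]
  refine ⟨Subgroup.le_normalizer, ?_⟩
  rw [Subgroup.closure_le]
  rintro _ ⟨i, rfl⟩
  have key : ∀ g ∈ Subgroup.closure (Set.range (a : Fin n → HTilde n)),
      s i * g * (s i)⁻¹ ∈ Subgroup.closure (Set.range (a : Fin n → HTilde n)) := by
    suffices Subgroup.closure (Set.range (a : Fin n → HTilde n)) ≤
        (Subgroup.closure (Set.range a)).comap (MulAut.conj (s i)).toMonoidHom from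
      fun g hg => this hg
    rw [Subgroup.closure_le]
    rintro _ ⟨j, rfl⟩
    change s i * a j * (s i)⁻¹ ∈ Subgroup.closure (Set.range a)
    rw [s_mul_a_mul_s_inv]
    exact Subgroup.subset_closure ⟨_, rfl⟩
  refine Subgroup.mem_normalizer_iff.mpr fun g => ⟨key g, fun hg => ?_⟩
  have := key _ hg
  rw [s_inv] at this
  simpa only [mul_assoc, s_mul_s, mul_one, ← mul_assoc (s i) (s i), one_mul] using this

theorem card_closure_s (hn : 1 ≤ n) :
    Finite (Subgroup.closure (Set.range (s : Fin (n - 1) → HTilde n))) ∧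
    Nat.card (Subgroup.closure (Set.range (s : Fin (n - 1) → HTilde n))) ≤ n.factorial := by
  let t : ℕ → HTilde n := fun i => if h : i < n - 1 then s ⟨i, h⟩ else 1
  have ht : ∀ i (h : i < n - 1), t i = s ⟨i, h⟩ := fun i h => dif_pos h
  have ht' : ∀ i, ¬ i < n - 1 → t i = 1 := fun i h => dif_neg h
  have himg : t '' Set.Iio (n - 1) = Set.range s := by
    ext x
    constructor
    · rintro ⟨i, hi, rfl⟩
      exact ⟨⟨i, hi⟩, (ht i hi).symm⟩
    · rintro ⟨i, rfl⟩
      exact ⟨i, i.2, ht i i.2⟩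
  have := card_closure_le_factorial (s := t) (m := n - 1) (fun i => ?_) (fun i hi => ?_)
    (fun i j hij => ?_) (n - 1) le_rfl
  · rwa [himg, Nat.sub_add_cancel hn] at this
  · by_cases h : i < n - 1
    · rw [ht i h, s_mul_s]
    · rw [ht' i h, one_mul]
  · rw [ht i (by omega), ht (i + 1) hi]
    exact s_braid rfl
  · by_cases h : j < n - 1
    · rw [ht i (by omega), ht j h]
      exact s_comm hij
    · rw [ht' j h, one_mul, mul_one]

theorem closure_swap_eq_top (hn : 1 ≤ n) :
    Subgroup.closure (Set.range fun i : Fin (n - 1) => Equiv.swap (idx1 i) (idx2 i)) = ⊤ := by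
  obtain ⟨n, rfl⟩ : ∃ m, n = m + 1 := ⟨n - 1, by omega⟩
  rw [eq_top_iff]
  intro σ _
  have h : σ ∈ Submonoid.closure (Set.range fun i : Fin n ↦ Equiv.swap i.castSucc i.succ) := by
    rw [Equiv.Perm.mclosure_swap_castSucc_succ]
    trivial
  exact Subgroup.le_closure_toSubmonoid _ h

theorem bijective_closure_s (hn : 1 ≤ n) {f : HTilde n →* Equiv.Perm (Fin n)}
    (hf : ∀ i, f (s i) = Equiv.swap (idx1 i) (idx2 i)) :
    Function.Bijective (f.comp (Subgroup.closure (Set.range s)).subtype) := by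
  obtain ⟨hfin, hle⟩ := card_closure_s hn
  have hsurj : Function.Surjective (f.comp (Subgroup.closure (Set.range s)).subtype) := by
    rw [← MonoidHom.range_eq_top, MonoidHom.range_comp, Subgroup.range_subtype,
      MonoidHom.map_closure, ← Set.range_comp, ← closure_swap_eq_top hn]
    congr 2
    exact funext hf
  refine hsurj.bijective_of_nat_card_le (hle.trans ?_)
  rw [Nat.card_perm, Nat.card_fin]

theorem le_card_closure_a (hn : 1 ≤ n)
    [Finite (Subgroup.closure (Set.range (a : Fin n → HTilde n)))] :
    2 ^ (n + 1) ≤ Nat.card (Subgroup.closure (Set.range (a : Fin n → HTilde n))) := by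
  obtain ⟨f, ha, hz⟩ := exists_hom_translation (n := n)
  set K := Subgroup.closure (Set.range (a : Fin n → HTilde n)) with hK
  let g := f.comp K.subtype
  have hrange : ∀ v : Fin n → ZMod 2, Equiv.addLeft v ∈ g.range := by
    let T : AddSubmonoid (Fin n → ZMod 2) :=
      { carrier := {v | Equiv.addLeft v ∈ g.range}
        zero_mem' := by
          simp only [Set.mem_ofPred_eq, Equiv.addLeft_zero]
          exact one_mem _
        add_mem' := fun {v w} hv hw => by
          simp only [Set.mem_ofPred_eq, Equiv.addLeft_add] at *
          exact mul_mem hv hw }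
    intro v
    change v ∈ T
    rw [← Finset.univ_sum_single v]
    refine sum_mem fun j _ => ?_
    generalize v j = c
    fin_cases c
    · change Pi.single j 0 ∈ T
      rw [Pi.single_zero]
      exact zero_mem T
    · exact ⟨⟨a j, Subgroup.subset_closure ⟨j, rfl⟩⟩, ha j⟩
  have hzK : z ∈ K := by
    rw [← a_mul_a ⟨0, hn⟩]
    exact mul_mem (Subgroup.subset_closure ⟨_, rfl⟩) (Subgroup.subset_closure ⟨_, rfl⟩)
  have hker : 2 ≤ Nat.card g.ker := by
    have : Nontrivial g.ker :=
      ⟨⟨⟨⟨z, hzK⟩, hz⟩, 1, fun h => z_ne_one (congrArg (fun x : g.ker => (x : HTilde n)) h)⟩⟩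
    exact Finite.one_lt_card
  have hran : 2 ^ n ≤ Nat.card g.range := by
    have hinj : Function.Injective fun v : Fin n → ZMod 2 =>
        (⟨Equiv.addLeft v, hrange v⟩ : g.range) := fun v w h => by
      simpa using Equiv.congr_fun (congrArg Subtype.val h) 0
    simpa [Nat.card_pi] using Nat.card_le_card_of_injective _ hinj
  rw [← Subgroup.card_mul_index g.ker, Subgroup.index_ker, pow_succ']
  exact Nat.mul_le_mul hker hran

theorem card_closure_a (hn : 1 ≤ n) :
    Nat.card (Subgroup.closure (Set.range (a : Fin n → HTilde n))) = 2 ^ (n + 1) := by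
  have hle := card_closure_le_two_pow z_mul_z a_mul_a (a_mul_a_of_ne (n := n)) n le_rfl
  have himg : (a : Fin n → HTilde n) '' {j | (j : ℕ) < n} = Set.range a := by
    simp [Set.image_univ]
  have hmem : (z : HTilde n) ∈ Subgroup.closure (Set.range (a : Fin n → HTilde n)) := by
    rw [← a_mul_a ⟨0, hn⟩]
    exact mul_mem (Subgroup.subset_closure ⟨_, rfl⟩) (Subgroup.subset_closure ⟨_, rfl⟩)
  rw [himg, Set.insert_eq, Subgroup.closure_union, sup_eq_right.mpr
    ((Subgroup.closure_le _).mpr (Set.singleton_subset_iff.mpr hmem))] at hle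
  have := hle.1
  exact le_antisymm hle.2 (le_card_closure_a hn)

end HTilde

theorem internal_semidirect (n : ℕ) (hn : 2 ≤ n) :
    (Subgroup.closure
        (Set.range fun j : Fin n => (PresentedGroup.of (HGen.a j) : HTilde n))).Normal ∧
    Nat.card (Subgroup.closure
        (Set.range fun j : Fin n => (PresentedGroup.of (HGen.a j) : HTilde n))) = 2 ^ (n + 1) ∧
    Nat.card (Subgroup.closure
        (Set.range fun i : Fin (n - 1) => (PresentedGroup.of (HGen.s i) : HTilde n))) =
      n.factorial ∧
    (Subgroup.closure (Set.range fun j : Fin n => (PresentedGroup.of (HGen.a j) : HTilde n)) ⊓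
      Subgroup.closure
        (Set.range fun i : Fin (n - 1) => (PresentedGroup.of (HGen.s i) : HTilde n)) = ⊥) ∧
    (Subgroup.closure (Set.range fun j : Fin n => (PresentedGroup.of (HGen.a j) : HTilde n)) ⊔
      Subgroup.closure
        (Set.range fun i : Fin (n - 1) => (PresentedGroup.of (HGen.s i) : HTilde n)) = ⊤) := by
  have hn : 1 ≤ n := by omega
  obtain ⟨f, hs, ha⟩ := HTilde.exists_hom_perm (n := n)
  have hbij := HTilde.bijective_closure_s hn hs
  refine ⟨HTilde.normal_closure_a hn, HTilde.card_closure_a hn, ?_, ?_,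
    HTilde.closure_a_sup_closure_s hn⟩
  · refine (Nat.card_eq_of_bijective _ hbij).trans ?_
    rw [Nat.card_perm, Nat.card_fin]
  · rw [eq_bot_iff]
    rintro x ⟨hxA, hxS⟩
    have hker : Subgroup.closure (Set.range HTilde.a) ≤ f.ker := by
      rw [Subgroup.closure_le]
      rintro _ ⟨j, rfl⟩
      exact ha j
    have hx : (⟨x, hxS⟩ : Subgroup.closure (Set.range HTilde.s)) = 1 :=
      hbij.1 ((hker hxA).trans (map_one _).symm)
    exact congrArg Subtype.val hx

end SpinHyperoctahedralStmt2
end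

section
/- Let n ≥ 1. The spin symmetric group S̃_n is a finite group of order 2·n!; in particular z ≠ 1 in S̃_n and the quotient of S̃_n by the subgroup generated by z is isomorphic to the symmetric group Perm(Fin n). -/
/-!
STATEMENT 3: for `n ≥ 1`, the spin symmetric group `S̃ₙ` (presented by
`t₁, …, t_{n−1}, z` with `z` central, `z² = 1`, `tᵢ² = z`,
`(tᵢt_{i+1})³ = 1`, `tᵢtⱼ = z tⱼtᵢ` for `|i−j| ≥ 2`) is a finite group of
order `2·n!`; in particular `z ≠ 1` and the quotient of `S̃ₙ` by the subgroup
generated by `z` (which coincides with its normal closure) is isomorphic to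
the symmetric group `Perm (Fin n)`.
-/

namespace SpinSymmetric

/-- Generators `t i` (`1 ≤ i ≤ n−1`, indexed by `Fin (n-1)`) and `z`. -/
inductive SGen (n : ℕ) : Type
  | t : Fin (n - 1) → SGen n
  | z : SGen n

variable {n : ℕ}

def T (i : Fin (n - 1)) : FreeGroup (SGen n) := FreeGroup.of (SGen.t i)
def Z : FreeGroup (SGen n) := FreeGroup.of (SGen.z)

/-- The defining relations of `S̃ₙ`. -/
def sRels (n : ℕ) : Set (FreeGroup (SGen n)) :=
  { w | (∃ i : Fin (n - 1), w = Z * T i * Z⁻¹ * (T i)⁻¹)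
    ∨ (w = Z ^ 2)
    ∨ (∃ i : Fin (n - 1), w = T i ^ 2 * Z⁻¹)
    ∨ (∃ i j : Fin (n - 1), (j : ℕ) = (i : ℕ) + 1 ∧ w = (T i * T j) ^ 3)
    ∨ (∃ i j : Fin (n - 1), ((i : ℕ) + 2 ≤ (j : ℕ) ∨ (j : ℕ) + 2 ≤ (i : ℕ)) ∧
        w = T i * T j * (T i)⁻¹ * (T j)⁻¹ * Z⁻¹) }

/-- The spin symmetric group `S̃ₙ`. -/
abbrev SpinSym (n : ℕ) := PresentedGroup (sRels n)

section TypeA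

variable {G : Type*} [Group G]

/-- `s 0, …, s (N - 1)` satisfy the Coxeter relations of type `A_N`. -/
structure SatisfiesTypeA (s : ℕ → G) (N : ℕ) : Prop where
  sq : ∀ i < N, s i * s i = 1
  braid : ∀ i, i + 1 < N → s (i + 1) * s i * s (i + 1) = s i * s (i + 1) * s i
  comm : ∀ i j, i + 2 ≤ j → j < N → s i * s j = s j * s i

/-- The subgroup generated by `s 0, …, s (m - 1)`. -/
def initialSubgroup (s : ℕ → G) (m : ℕ) : Subgroup G :=
  Subgroup.closure (s '' Set.Iio m)

lemma mem_initialSubgroup (s : ℕ → G) {i m : ℕ} (h : i < m) : s i ∈ initialSubgroup s m :=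
  Subgroup.subset_closure ⟨i, h, rfl⟩

lemma initialSubgroup_mono (s : ℕ → G) : Monotone (initialSubgroup s) :=
  fun _ _ h => Subgroup.closure_mono (Set.image_mono (Set.Iio_subset_Iio h))

lemma initialSubgroup_zero (s : ℕ → G) : initialSubgroup s 0 = ⊥ := by
  simp [initialSubgroup]

variable {s : ℕ → G} {N : ℕ}

lemma SatisfiesTypeA.commute_of_mem (hs : SatisfiesTypeA s N) {m : ℕ} (hm : m + 1 < N) {b : G}
    (hb : b ∈ initialSubgroup s m) : s (m + 1) * b = b * s (m + 1) := by
  have h : initialSubgroup s m ≤ Subgroup.centralizer {s (m + 1)} := by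
    refine (Subgroup.closure_le _).2 ?_
    rintro _ ⟨i, hi, rfl⟩
    rw [SetLike.mem_coe, Subgroup.mem_centralizer_singleton_iff]
    have hi : i < m := hi
    exact hs.comm i (m + 1) (by omega) hm
  exact (Subgroup.mem_centralizer_singleton_iff.1 (h hb)).symm

lemma SatisfiesTypeA.mem_or_mem_doubleCoset (hs : SatisfiesTypeA s N) {m : ℕ} (hm : m < N) :
    ∀ x ∈ initialSubgroup s (m + 1), x ∈ initialSubgroup s m ∨
      ∃ a ∈ initialSubgroup s m, ∃ b ∈ initialSubgroup s m, x = a * s m * b := by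
  induction m with
  | zero =>
    have key : ∀ x : G, (x = 1 ∨ x = s 0) → (x * s 0 = 1 ∨ x * s 0 = s 0) := by
      rintro x (rfl | rfl)
      · simp
      · simp [hs.sq 0 hm]
    intro x hx
    suffices x = 1 ∨ x = s 0 by simpa [initialSubgroup_zero] using this
    have hinv : (s 0)⁻¹ = s 0 := inv_eq_of_mul_eq_one_right (hs.sq 0 hm)
    induction hx using Subgroup.closure_induction_right with
    | one => simp
    | mul_right x hx y hy ih =>
      obtain ⟨i, hi, rfl⟩ := hy
      obtain rfl : i = 0 := by simpa using hi
      exact key x ih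
    | mul_inv_cancel x hx y hy ih =>
      obtain ⟨i, hi, rfl⟩ := hy
      obtain rfl : i = 0 := by simpa using hi
      rw [hinv]
      exact key x ih
  | succ k IH =>
    have key : ∀ x : G, (x ∈ initialSubgroup s (k + 1) ∨ ∃ a ∈ initialSubgroup s (k + 1),
        ∃ b ∈ initialSubgroup s (k + 1), x = a * s (k + 1) * b) → ∀ i < k + 2,
        (x * s i ∈ initialSubgroup s (k + 1) ∨ ∃ a ∈ initialSubgroup s (k + 1),
          ∃ b ∈ initialSubgroup s (k + 1), x * s i = a * s (k + 1) * b) := by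
      intro x hx i hi
      rcases Nat.lt_succ_iff_lt_or_eq.1 hi with hi | rfl
      · have hsi := mem_initialSubgroup s hi
        rcases hx with hx | ⟨a, ha, b, hb, rfl⟩
        · exact .inl (mul_mem hx hsi)
        · exact .inr ⟨a, ha, b * s i, mul_mem hb hsi, by group⟩
      · rcases hx with hx | ⟨a, ha, b, hb, rfl⟩
        · exact .inr ⟨x, hx, 1, one_mem _, by simp⟩
        have hle := initialSubgroup_mono s k.le_succ
        rcases IH (by omega) b hb with hb' | ⟨g, hg, g', hg', rfl⟩
        · left
          have : a * s (k + 1) * b * s (k + 1) = a * b := by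
            rw [mul_assoc a, hs.commute_of_mem hm hb', ← mul_assoc, mul_assoc _ (s _),
              hs.sq _ hm, mul_one]
          exact this ▸ mul_mem ha hb
        · right
          refine ⟨a * g * s k, mul_mem (mul_mem ha (hle hg)) (mem_initialSubgroup s k.lt_succ_self),
            s k * g', mul_mem (mem_initialSubgroup s k.lt_succ_self) (hle hg'), ?_⟩
          calc a * s (k + 1) * (g * s k * g') * s (k + 1)
              = a * (s (k + 1) * g) * s k * (g' * s (k + 1)) := by group
            _ = a * (g * s (k + 1)) * s k * (s (k + 1) * g') := by
              rw [hs.commute_of_mem hm hg, hs.commute_of_mem hm hg']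
            _ = a * g * (s (k + 1) * s k * s (k + 1)) * g' := by group
            _ = a * g * s k * s (k + 1) * (s k * g') := by rw [hs.braid k hm]; group
    intro x hx
    induction hx using Subgroup.closure_induction_right with
    | one => exact .inl (one_mem _)
    | mul_right x hx y hy ih =>
      obtain ⟨i, hi, rfl⟩ := hy
      exact key x ih i hi
    | mul_inv_cancel x hx y hy ih =>
      obtain ⟨i, hi, rfl⟩ := hy
      have hi' : i < k + 2 := hi
      rw [inv_eq_of_mul_eq_one_right (hs.sq i (by omega))]
      exact key x ih i hi

lemma SatisfiesTypeA.exists_coset_representatives (hs : SatisfiesTypeA s N) {m : ℕ} (hm : m < N) :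
    ∃ R : Finset G, R.card ≤ m + 2 ∧ ∀ x ∈ initialSubgroup s (m + 1),
      ∃ h ∈ initialSubgroup s m, ∃ r ∈ R, x = h * r := by
  classical
  induction m with
  | zero =>
    refine ⟨{1, s 0}, Finset.card_le_two, fun x hx => ?_⟩
    have := hs.mem_or_mem_doubleCoset hm x hx
    simpa [initialSubgroup_zero] using this
  | succ m ih =>
    obtain ⟨R, hR, hcov⟩ := ih (by omega)
    refine ⟨insert 1 (R.image (s (m + 1) * ·)), ?_, fun x hx => ?_⟩
    · have h₁ := Finset.card_insert_le 1 (R.image (s (m + 1) * ·))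
      have h₂ : (R.image (s (m + 1) * ·)).card ≤ R.card := Finset.card_image_le
      omega
    · rcases hs.mem_or_mem_doubleCoset hm x hx with hx | ⟨a, ha, b, hb, rfl⟩
      · exact ⟨x, hx, 1, by simp, by simp⟩
      · obtain ⟨h, hh, r, hr, rfl⟩ := hcov b hb
        refine ⟨a * h, mul_mem ha (initialSubgroup_mono s m.le_succ hh), s (m + 1) * r,
          Finset.mem_insert_of_mem (Finset.mem_image_of_mem _ hr), ?_⟩
        rw [mul_assoc a, ← mul_assoc _ h, hs.commute_of_mem hm hh]
        group

lemma SatisfiesTypeA.exists_finset_covering (hs : SatisfiesTypeA s N) {m : ℕ} (hm : m ≤ N) :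
    ∃ F : Finset G, F.card ≤ (m + 1).factorial ∧ ∀ x ∈ initialSubgroup s m, x ∈ F := by
  classical
  induction m with
  | zero => exact ⟨{1}, by simp, by simp [initialSubgroup_zero]⟩
  | succ m ih =>
    obtain ⟨F, hF, hmem⟩ := ih (by omega)
    obtain ⟨R, hR, hcov⟩ := hs.exists_coset_representatives (m := m) (by omega)
    refine ⟨Finset.image₂ (· * ·) F R, ?_, fun x hx => ?_⟩
    · calc (Finset.image₂ (· * ·) F R).card ≤ F.card * R.card := Finset.card_image₂_le _ _ _
        _ ≤ (m + 1).factorial * (m + 2) := Nat.mul_le_mul hF hR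
        _ = (m + 1 + 1).factorial := by rw [Nat.factorial_succ (m + 1), mul_comm]
    · obtain ⟨h, hh, r, hr, rfl⟩ := hcov x hx
      exact Finset.mem_image₂_of_mem (hmem h hh) hr

/-- A group generated by elements satisfying the Coxeter relations of type `A_N` is finite, of order
at most `(N + 1)!`. -/
lemma SatisfiesTypeA.finite_and_card_le (hs : SatisfiesTypeA s N) (hgen : initialSubgroup s N = ⊤) :
    Finite G ∧ Nat.card G ≤ (N + 1).factorial := by
  obtain ⟨F, hF, hmem⟩ := hs.exists_finset_covering le_rfl
  have huniv : (F : Set G) = Set.univ := Set.eq_univ_of_forall fun x => hmem x (by simp [hgen])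
  have hfin : Finite G := Set.finite_univ_iff.1 (huniv ▸ F.finite_toSet)
  refine ⟨hfin, ?_⟩
  rwa [← Nat.card_univ, ← huniv, Nat.card_eq_card_toFinset, Finset.toFinset_coe]

end TypeA

section Relations

variable (n)

lemma of_z_sq : (PresentedGroup.of SGen.z : SpinSym n) ^ 2 = 1 :=
  PresentedGroup.one_of_mem (rels := sRels n) (.inr (.inl rfl))

variable {n}

lemma of_t_sq (i : Fin (n - 1)) :
    (PresentedGroup.of (SGen.t i) : SpinSym n) ^ 2 = PresentedGroup.of SGen.z :=
  mul_inv_eq_one.1 <| PresentedGroup.one_of_mem (rels := sRels n) (.inr (.inr (.inl ⟨i, rfl⟩)))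

lemma of_t_mul_of_t_pow_three {i j : Fin (n - 1)} (h : (j : ℕ) = i + 1) :
    ((PresentedGroup.of (SGen.t i) : SpinSym n) * PresentedGroup.of (SGen.t j)) ^ 3 = 1 :=
  PresentedGroup.one_of_mem (rels := sRels n) (.inr (.inr (.inr (.inl ⟨i, j, h, rfl⟩))))

lemma commutator_of_t {i j : Fin (n - 1)} (h : (i : ℕ) + 2 ≤ j) :
    (PresentedGroup.of (SGen.t i) : SpinSym n) * PresentedGroup.of (SGen.t j) *
      (PresentedGroup.of (SGen.t i))⁻¹ * (PresentedGroup.of (SGen.t j))⁻¹ =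
      PresentedGroup.of SGen.z :=
  mul_inv_eq_one.1 <| PresentedGroup.one_of_mem (rels := sRels n)
    (.inr (.inr (.inr (.inr ⟨i, j, .inl h, rfl⟩))))

lemma of_z_mem_center : (PresentedGroup.of SGen.z : SpinSym n) ∈ Subgroup.center (SpinSym n) := by
  suffices h : Subgroup.centralizer {(PresentedGroup.of SGen.z : SpinSym n)} = ⊤ from
    Subgroup.mem_center_iff.2 fun g =>
      Subgroup.mem_centralizer_singleton_iff.1 (h ▸ Subgroup.mem_top g)
  rw [eq_top_iff, ← PresentedGroup.closure_range_of, Subgroup.closure_le]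
  rintro _ ⟨i | _, rfl⟩
  · rw [SetLike.mem_coe, Subgroup.mem_centralizer_singleton_iff]
    have h := PresentedGroup.one_of_mem (rels := sRels n) (.inl ⟨i, rfl⟩)
    exact (mul_inv_eq_iff_eq_mul.1 (mul_inv_eq_one.1 h)).symm
  · exact Subgroup.mem_centralizer_singleton_iff.2 rfl

lemma normalClosure_of_z : Subgroup.normalClosure {(PresentedGroup.of SGen.z : SpinSym n)} =
    Subgroup.closure {(PresentedGroup.of SGen.z : SpinSym n)} := by
  have hle : Subgroup.closure {(PresentedGroup.of SGen.z : SpinSym n)} ≤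
      Subgroup.center (SpinSym n) := by
    simpa [Subgroup.closure_le] using of_z_mem_center
  have : (Subgroup.closure {(PresentedGroup.of SGen.z : SpinSym n)}).Normal :=
    ⟨fun g hg x => by rwa [Subgroup.mem_center_iff.1 (hle hg) x, mul_inv_cancel_right]⟩
  exact le_antisymm (Subgroup.normalClosure_le_normal Subgroup.subset_closure)
    Subgroup.closure_le_normalClosure

end Relations

section Clifford

open CliffordAlgebra

/-- A quadratic form on `ℚᵐ` with value `-1` at each basis vector, and whose polar form is `-1` at
adjacent basis vectors and `0` at distant ones. -/
noncomputable def spinForm (m : ℕ) : QuadraticForm ℚ (Fin m → ℚ) :=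
  LinearMap.BilinMap.toQuadraticMap (Matrix.toBilin'
    (Matrix.of fun i j : Fin m => if i = j ∨ (j : ℕ) = i + 1 then (-1 : ℚ) else 0))

/-- The Clifford generator attached to a basis vector. -/
noncomputable def spinGen {m : ℕ} (i : Fin m) : CliffordAlgebra (spinForm m) :=
  ι (spinForm m) (Pi.single i 1)

lemma spinGen_mul_self {m : ℕ} (i : Fin m) : spinGen i * spinGen i = -1 := by
  rw [spinGen, ι_sq_scalar, spinForm, LinearMap.BilinMap.toQuadraticMap_apply,
    Matrix.toBilin'_single]
  simp

lemma spinGen_mul_add_swap_of_adjacent {m : ℕ} {i j : Fin m} (h : (j : ℕ) = i + 1) :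
    spinGen i * spinGen j + spinGen j * spinGen i = -1 := by
  rw [spinGen, spinGen, ι_mul_ι_add_swap, spinForm, LinearMap.BilinMap.polar_toQuadraticMap,
    Matrix.toBilin'_single, Matrix.toBilin'_single]
  have h₁ : j ≠ i := by rintro rfl; omega
  have h₂ : ¬ (i : ℕ) = i + 1 + 1 := by omega
  simp [h, h₁, h₁.symm, h₂]

lemma spinGen_mul_swap_of_distant {m : ℕ} {i j : Fin m}
    (h : (i : ℕ) + 2 ≤ j ∨ (j : ℕ) + 2 ≤ i) :
    spinGen i * spinGen j = -(spinGen j * spinGen i) := by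
  rw [eq_neg_iff_add_eq_zero, spinGen, spinGen, ι_mul_ι_add_swap, spinForm,
    LinearMap.BilinMap.polar_toQuadraticMap, Matrix.toBilin'_single, Matrix.toBilin'_single]
  have h₁ : j ≠ i := by rintro rfl; omega
  have h₂ : ¬ (i : ℕ) = j + 1 := by omega
  have h₃ : ¬ (j : ℕ) = i + 1 := by omega
  simp [h₁, h₁.symm, h₂, h₃]

lemma pow_three_eq_one_of_mul_add_swap {A : Type*} [Ring A] {a b : A} (ha : a * a = -1)
    (hb : b * b = -1) (hab : a * b + b * a = -1) : (a * b) ^ 3 = 1 := by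
  have hba : b * a = -1 - a * b := by rw [← hab]; abel
  have hsq : a * b * (a * b) = -(a * b) - 1 := by
    calc a * b * (a * b) = a * (b * a) * b := by noncomm_ring
      _ = -(a * b) - a * a * (b * b) := by rw [hba]; noncomm_ring
      _ = -(a * b) - 1 := by rw [ha, hb]; noncomm_ring
  rw [pow_succ, sq, hsq, sub_mul, neg_mul, hsq, one_mul]
  abel

/-- The Clifford generator `spinGen i` as a unit. -/
noncomputable def spinUnit {m : ℕ} (i : Fin m) : (CliffordAlgebra (spinForm m))ˣ where
  val := spinGen i
  inv := -spinGen i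
  val_inv := by rw [mul_neg, spinGen_mul_self, neg_neg]
  inv_val := by rw [neg_mul, spinGen_mul_self, neg_neg]

/-- The images of the generators under the basic spin representation. -/
noncomputable def spinRepGen (n : ℕ) : SGen n → (CliffordAlgebra (spinForm (n - 1)))ˣ
  | .t i => spinUnit i
  | .z => -1

lemma spinRepGen_rels (n : ℕ) : ∀ r ∈ sRels n, FreeGroup.lift (spinRepGen n) r = 1 := by
  rintro r (⟨i, rfl⟩ | rfl | ⟨i, rfl⟩ | ⟨i, j, h, rfl⟩ | ⟨i, j, h, rfl⟩)
  · simp [T, Z, spinRepGen]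
  · simp [Z, spinRepGen]
  · simp only [T, Z, spinRepGen, map_mul, map_inv, FreeGroup.lift_apply_of, mul_inv_eq_one,
      sq]
    exact Units.ext (spinGen_mul_self i)
  · simp only [T, spinRepGen, map_mul, map_pow, FreeGroup.lift_apply_of]
    exact Units.ext <| pow_three_eq_one_of_mul_add_swap (spinGen_mul_self i) (spinGen_mul_self j)
      (spinGen_mul_add_swap_of_adjacent h)
  · simp only [T, Z, spinRepGen, map_mul, map_inv, FreeGroup.lift_apply_of,
      mul_inv_eq_iff_eq_mul, one_mul]
    refine Units.ext ((spinGen_mul_swap_of_distant h).trans ?_)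
    simp [spinUnit]

lemma of_z_ne_one (n : ℕ) : (PresentedGroup.of SGen.z : SpinSym n) ≠ 1 := by
  intro h
  have h' := congrArg (PresentedGroup.toGroup (spinRepGen_rels n)) h
  rw [PresentedGroup.toGroup.of, map_one, spinRepGen, Units.ext_iff, Units.val_neg,
    Units.val_one] at h'
  have h₂ : (algebraMap ℚ (CliffordAlgebra (spinForm (n - 1)))) (-1) = algebraMap ℚ _ 1 := by
    simpa using h'
  have := (algebraMap ℚ (CliffordAlgebra (spinForm (n - 1)))).injective h₂
  norm_num at this

end Clifford

section Permutation

/-- The images of the generators in the symmetric group. -/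
def permGen (m : ℕ) : SGen (m + 1) → Equiv.Perm (Fin (m + 1))
  | .t i => Equiv.swap (Fin.castSucc i) (Fin.succ i)
  | .z => 1

lemma permGen_rels (m : ℕ) : ∀ r ∈ sRels (m + 1), FreeGroup.lift (permGen m) r = 1 := by
  rintro r (⟨i, rfl⟩ | rfl | ⟨i, rfl⟩ | ⟨i, j, h, rfl⟩ | ⟨i, j, h, rfl⟩)
  · simp [T, Z, permGen]
  · simp [Z, permGen]
  · simp [T, Z, permGen, sq]
  · have hij : j.castSucc = i.succ := Fin.ext h
    have h₁ : i.succ ≠ i.castSucc := by simp [Fin.ext_iff]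
    have h₂ : i.succ ≠ j.succ := by simp [Fin.ext_iff, h]
    have h₃ : i.castSucc ≠ j.succ := by simp [Fin.ext_iff, h]; omega
    simp only [T, permGen, map_mul, map_pow, FreeGroup.lift_apply_of]
    rw [hij, Equiv.swap_comm i.castSucc,
      ← (Equiv.Perm.isThreeCycle_swap_mul_swap_same h₁ h₂ h₃).orderOf]
    exact pow_orderOf_eq_one _
  · simp only [T, Z, permGen, map_mul, map_inv, FreeGroup.lift_apply_of, inv_one, mul_one,
      mul_inv_eq_iff_eq_mul, one_mul]
    refine (Equiv.Perm.disjoint_swap_swap ?_).commute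
    simp [Fin.ext_iff]
    omega

/-- The quotient of `SpinSym (m + 1)` by `z` maps to the symmetric group. -/
def quotientToPerm (m : ℕ) :
    (SpinSym (m + 1) ⧸ Subgroup.normalClosure {(PresentedGroup.of SGen.z : SpinSym (m + 1))}) →*
      Equiv.Perm (Fin (m + 1)) :=
  QuotientGroup.lift _ (PresentedGroup.toGroup (permGen_rels m)) <| by
    refine Subgroup.normalClosure_le_normal ?_
    rw [Set.singleton_subset_iff, SetLike.mem_coe, MonoidHom.mem_ker, PresentedGroup.toGroup.of]
    rfl

lemma quotientToPerm_surjective (m : ℕ) : Function.Surjective (quotientToPerm m) := by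
  have h : MonoidHom.mrange (quotientToPerm m) = ⊤ := by
    rw [eq_top_iff, ← Equiv.Perm.mclosure_swap_castSucc_succ, Submonoid.closure_le]
    rintro _ ⟨i, rfl⟩
    exact ⟨QuotientGroup.mk (PresentedGroup.of (SGen.t i)),
      PresentedGroup.toGroup.of (permGen_rels m)⟩
  exact MonoidHom.mrange_eq_top.1 h

/-- The images of the generators `t i` in the quotient by `z`, extended by `1`. -/
def quotientGen (m i : ℕ) :
    SpinSym (m + 1) ⧸ Subgroup.normalClosure {(PresentedGroup.of SGen.z : SpinSym (m + 1))} :=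
  if h : i < m then QuotientGroup.mk (PresentedGroup.of (SGen.t ⟨i, h⟩)) else 1

lemma mk_of_z (m : ℕ) : (QuotientGroup.mk (PresentedGroup.of SGen.z) :
    SpinSym (m + 1) ⧸ Subgroup.normalClosure {(PresentedGroup.of SGen.z : SpinSym (m + 1))}) = 1 :=
  (QuotientGroup.eq_one_iff _).2 (Subgroup.subset_normalClosure rfl)

lemma satisfiesTypeA_quotientGen (m : ℕ) : SatisfiesTypeA (quotientGen m) m := by
  have hsq : ∀ i < m, quotientGen m i * quotientGen m i = 1 := by
    intro i hi
    rw [quotientGen, dif_pos hi]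
    exact (congrArg QuotientGroup.mk ((sq _).symm.trans (of_t_sq (n := m + 1) ⟨i, hi⟩))).trans
      (mk_of_z m)
  refine ⟨hsq, fun i hi => ?_, fun i j hij hj => ?_⟩
  · have h₁ : i < m := by omega
    have h : (quotientGen m i * quotientGen m (i + 1)) ^ 3 = 1 := by
      rw [quotientGen, quotientGen, dif_pos h₁, dif_pos hi]
      exact congrArg QuotientGroup.mk (of_t_mul_of_t_pow_three (n := m + 1) (i := ⟨i, h₁⟩)
        (j := ⟨i + 1, hi⟩) rfl)
    have ha : (quotientGen m i)⁻¹ = quotientGen m i := inv_eq_of_mul_eq_one_right (hsq i h₁)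
    have hb : (quotientGen m (i + 1))⁻¹ = quotientGen m (i + 1) :=
      inv_eq_of_mul_eq_one_right (hsq _ hi)
    generalize quotientGen m i = a at *
    generalize quotientGen m (i + 1) = b at *
    have h' : (a * b * a) * (b * a * b) = 1 := by
      rw [← h, pow_succ, sq]
      group
    rw [← inv_eq_of_mul_eq_one_right h', mul_inv_rev, mul_inv_rev, ha, hb, mul_assoc]
  · have h₁ : i < m := by omega
    have h := congrArg (QuotientGroup.mk' (Subgroup.normalClosure
      {(PresentedGroup.of SGen.z : SpinSym (m + 1))}))
      (commutator_of_t (n := m + 1) (i := ⟨i, h₁⟩) (j := ⟨j, hj⟩) hij)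
    simp only [map_mul, map_inv, QuotientGroup.mk'_apply, mk_of_z, mul_inv_eq_iff_eq_mul,
      one_mul] at h
    rw [quotientGen, quotientGen, dif_pos h₁, dif_pos hj]
    exact h

lemma initialSubgroup_quotientGen (m : ℕ) : initialSubgroup (quotientGen m) m = ⊤ := by
  set N := Subgroup.normalClosure {(PresentedGroup.of SGen.z : SpinSym (m + 1))}
  have h : (⊤ : Subgroup (SpinSym (m + 1))) ≤
      (initialSubgroup (quotientGen m) m).comap (QuotientGroup.mk' N) := by
    rw [← PresentedGroup.closure_range_of, Subgroup.closure_le]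
    rintro _ ⟨i | _, rfl⟩
    · have hi : (i : ℕ) < m := i.2
      have := mem_initialSubgroup (quotientGen m) hi
      rw [quotientGen, dif_pos hi] at this
      exact this
    · rw [SetLike.mem_coe, Subgroup.mem_comap, QuotientGroup.mk'_apply, mk_of_z]
      exact one_mem _
  refine eq_top_iff.2 fun x _ => ?_
  obtain ⟨y, rfl⟩ := QuotientGroup.mk'_surjective N x
  exact h (Subgroup.mem_top y)

end Permutation

theorem spinSym_card_and_quotient (n : ℕ) (hn : 1 ≤ n) :
    Finite (SpinSym n) ∧
    Nat.card (SpinSym n) = 2 * n.factorial ∧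
    (PresentedGroup.of (SGen.z) : SpinSym n) ≠ 1 ∧
    Subgroup.normalClosure {(PresentedGroup.of (SGen.z) : SpinSym n)} =
      Subgroup.closure {(PresentedGroup.of (SGen.z) : SpinSym n)} ∧
    Nonempty
      ((SpinSym n ⧸ Subgroup.normalClosure {(PresentedGroup.of (SGen.z) : SpinSym n)}) ≃*
        Equiv.Perm (Fin n)) := by
  obtain ⟨m, rfl⟩ : ∃ m, n = m + 1 := ⟨n - 1, by omega⟩
  set N := Subgroup.normalClosure {(PresentedGroup.of SGen.z : SpinSym (m + 1))} with hN
  obtain ⟨hfin, hle⟩ :=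
    (satisfiesTypeA_quotientGen m).finite_and_card_le (initialSubgroup_quotientGen m)
  have hbij : Function.Bijective (quotientToPerm m) :=
    (quotientToPerm_surjective m).bijective_of_nat_card_le (by rwa [Nat.card_perm, Nat.card_fin])
  have hcardQ : Nat.card (SpinSym (m + 1) ⧸ N) = (m + 1).factorial := by
    rw [Nat.card_congr (Equiv.ofBijective _ hbij), Nat.card_perm, Nat.card_fin]
  have hcardN : Nat.card N = 2 := by
    rw [hN, normalClosure_of_z, ← Subgroup.zpowers_eq_closure, Nat.card_zpowers]
    exact orderOf_eq_prime (of_z_sq _) (of_z_ne_one _)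
  have hcard : Nat.card (SpinSym (m + 1)) = 2 * (m + 1).factorial := by
    rw [Subgroup.card_eq_card_quotient_mul_card_subgroup N, hcardQ, hcardN, mul_comm]
  refine ⟨Nat.finite_of_card_ne_zero ?_, hcard, of_z_ne_one _, normalClosure_of_z,
    ⟨MulEquiv.ofBijective _ hbij⟩⟩
  rw [hcard]
  positivity

end SpinSymmetric
end

section
/- Let n ≥ 1, r = ⌊n/2⌋, e_i = (1/2)(1 + √−1·ξ_{2i−1}ξ_{2i}) for 1 ≤ i ≤ r, and e = e_1e_2⋯e_r in 𝒞_n. Then the left ideal L_n = 𝒞_n·e, regarded as a ℂ-subspace of 𝒞_n, has dimension 2^{⌈n/2⌉}. -/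
namespace CliffordSpin

open CliffordAlgebra

/-- The quadratic form `Q(x) = x₁² + ⋯ + xₙ²` on `ℂⁿ`. -/
noncomputable def Qf (n : ℕ) : QuadraticForm ℂ (Fin n → ℂ) :=
  QuadraticMap.weightedSumSquares ℂ (fun _ : Fin n => (1 : ℂ))

/-- The Clifford algebra `𝒞ₙ`. -/
abbrev Cl (n : ℕ) := CliffordAlgebra (Qf n)

/-- The generators `ξᵢ` of `𝒞ₙ` (images of the standard basis vectors). -/
noncomputable def ξ (n : ℕ) (i : Fin n) : Cl n := CliffordAlgebra.ι (Qf n) (Pi.single i 1)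

/-- The idempotents `eᵢ = (1/2)(1 + √−1 ξ_{2i−1} ξ_{2i})` and their product
`e = e₁ ⋯ e_r`, `r = ⌊n/2⌋` (indices are 0-based here). -/
noncomputable def eIdem (n : ℕ) : Cl n :=
  ((List.finRange (n / 2)).map fun i : Fin (n / 2) =>
      (2 : ℂ)⁻¹ • (1 + Complex.I •
        (ξ n ⟨2 * (i : ℕ), by have := i.isLt; omega⟩ *
         ξ n ⟨2 * (i : ℕ) + 1, by have := i.isLt; omega⟩))).prod

/-- The left ideal `Lₙ = 𝒞ₙ·e`, as a ℂ-subspace of `𝒞ₙ`. -/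
noncomputable def Ln (n : ℕ) : Submodule ℂ (Cl n) := LinearMap.range (LinearMap.mulRight ℂ (eIdem n))


theorem _root_.List.isIdempotentElem_prod {M : Type*} [Monoid M] {l : List M}
    (hl : ∀ x ∈ l, IsIdempotentElem x) (hc : ∀ x ∈ l, ∀ y ∈ l, Commute x y) :
    IsIdempotentElem l.prod := by
  induction l with
  | nil => exact IsIdempotentElem.one
  | cons a l ih =>
    rw [List.prod_cons]
    refine IsIdempotentElem.mul_of_commute ?_ (hl a (by simp)) ?_
    · exact Commute.list_prod_right _ _ fun y hy => hc a (by simp) y (by simp [hy])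
    · exact ih (fun x hx => hl x (by simp [hx]))
        fun x hx y hy => hc x (by simp [hx]) y (by simp [hy])

/-- If each `p i` is conjugate to `1 - p i` under an involution `u i` commuting with the other
`p j`, then each factor `p i` of a product halves the value of a tracial functional. -/
theorem two_pow_length_mul_tracial_prod {K A κ : Type*} [CommRing K] [Ring A] [Algebra K A]
    (τ : A →ₗ[K] K) (hτ : ∀ x y, τ (x * y) = τ (y * x)) (p u : κ → A)
    (hu : ∀ i, u i * u i = 1) (hpu : ∀ i, p i * u i + u i * p i = u i)
    (hc : ∀ i j, i ≠ j → Commute (u i) (p j)) (l : List κ) (hl : l.Nodup) :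
    2 ^ l.length * τ (l.map p).prod = τ 1 := by
  induction l with
  | nil => simp
  | cons a l ih =>
    rw [List.nodup_cons] at hl
    have ih := ih hl.2
    rw [List.map_cons, List.prod_cons, List.length_cons, pow_succ, mul_assoc]
    set f := (l.map p).prod
    have huf : u a * f = f * u a := by
      refine Commute.list_prod_right _ _ fun y hy => ?_
      obtain ⟨j, hj, rfl⟩ := List.mem_map.1 hy
      exact hc a j (by rintro rfl; exact hl.1 hj)
    have hconj : τ (u a * p a * (u a * f)) = τ (p a * f) := by
      rw [mul_assoc, hτ, huf, mul_assoc, mul_assoc, hu, mul_one]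
    have hsplit : f = p a * f + u a * p a * (u a * f) := by
      calc f = (p a * u a + u a * p a) * (u a * f) := by
            rw [hpu, ← mul_assoc, hu, one_mul]
        _ = p a * f + u a * p a * (u a * f) := by
            rw [add_mul, mul_assoc (p a), ← mul_assoc (u a) (u a), hu, one_mul]
    have hτf : τ f = 2 * τ (p a * f) := by
      conv_lhs => rw [hsplit]
      rw [map_add, hconj, two_mul]
    rw [← hτf, ih]

theorem trace_mulRight_mul_comm {K A : Type*} [CommRing K] [Ring A] [Algebra K A] (x y : A) :
    LinearMap.trace K A (LinearMap.mulRight K (x * y)) =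
      LinearMap.trace K A (LinearMap.mulRight K (y * x)) := by
  rw [LinearMap.mulRight_mul, LinearMap.mulRight_mul]
  exact LinearMap.trace_mul_comm K _ _

theorem trace_mulRight_of_isIdempotentElem {K A : Type*} [Field K] [Ring A] [Algebra K A]
    [Module.Finite K A] {e : A} (he : IsIdempotentElem e) :
    LinearMap.trace K A (LinearMap.mulRight K e) =
      (Module.finrank K (LinearMap.range (LinearMap.mulRight K e)) : K) := by
  have h : IsIdempotentElem (LinearMap.mulRight K e) := by
    rw [IsIdempotentElem, Module.End.mul_eq_comp, ← LinearMap.mulRight_mul, he.eq]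
  exact (LinearMap.IsIdempotentElem.isProj_range _ h).trace

/-- The basis of `𝒞ₙ` corresponding to the standard basis of the exterior algebra of `ℂⁿ`. -/
noncomputable def basisCl (n : ℕ) : Module.Basis (Finset (Fin n)) ℂ (Cl n) :=
  (Pi.basisFun ℂ (Fin n)).ExteriorAlgebra.map (equivExterior (Qf n)).symm

theorem finrank_Cl (n : ℕ) : Module.finrank ℂ (Cl n) = 2 ^ n := by
  rw [Module.finrank_eq_card_basis (basisCl n), Fintype.card_finset, Fintype.card_fin]

theorem ξ_mul_self (n : ℕ) (i : Fin n) : ξ n i * ξ n i = 1 := by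
  have hQ : Qf n (Pi.single i 1) = 1 := by simp [Qf, Pi.single_apply]
  rw [ξ, ι_sq_scalar, hQ, map_one]

theorem ξ_mul_ξ_comm (n : ℕ) {i j : Fin n} (h : i ≠ j) : ξ n i * ξ n j = -(ξ n j * ξ n i) := by
  refine ι_mul_ι_comm_of_isOrtho ?_
  simp only [QuadraticMap.isOrtho_def, Qf, QuadraticMap.weightedSumSquares_apply, one_smul,
    Pi.add_apply, ← Finset.sum_add_distrib]
  refine Finset.sum_congr rfl fun k _ => ?_
  rcases eq_or_ne k i with rfl | hk <;> simp_all [Pi.single_apply]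

theorem commute_ξ_mul_ξ (n : ℕ) {i j k : Fin n} (hj : i ≠ j) (hk : i ≠ k) :
    Commute (ξ n i) (ξ n j * ξ n k) := by
  rw [commute_iff_eq, ← mul_assoc, ξ_mul_ξ_comm n hj, neg_mul, mul_assoc, ξ_mul_ξ_comm n hk,
    mul_neg, neg_neg, mul_assoc]

/-- The idempotent `(1/2)(1 + √−1 ξⱼ ξₖ)`. -/
noncomputable def pairIdem (n : ℕ) (j k : Fin n) : Cl n :=
  (2 : ℂ)⁻¹ • (1 + Complex.I • (ξ n j * ξ n k))

theorem commute_ξ_pairIdem (n : ℕ) {i j k : Fin n} (hj : i ≠ j) (hk : i ≠ k) :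
    Commute (ξ n i) (pairIdem n j k) :=
  ((Commute.one_right _).add_right ((commute_ξ_mul_ξ n hj hk).smul_right _)).smul_right _

theorem commute_pairIdem (n : ℕ) {i i' j k : Fin n} (hj : i ≠ j) (hk : i ≠ k) (hj' : i' ≠ j)
    (hk' : i' ≠ k) : Commute (pairIdem n i i') (pairIdem n j k) :=
  ((Commute.one_left _).add_left (((commute_ξ_pairIdem n hj hk).mul_left
    (commute_ξ_pairIdem n hj' hk')).smul_left _)).smul_left _

theorem isIdempotentElem_pairIdem (n : ℕ) {j k : Fin n} (h : j ≠ k) :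
    IsIdempotentElem (pairIdem n j k) := by
  have hsq : ξ n j * ξ n k * (ξ n j * ξ n k) = -1 := by
    rw [mul_assoc, ← mul_assoc (ξ n k), ξ_mul_ξ_comm n h.symm, neg_mul, mul_neg, mul_assoc,
      ξ_mul_self, mul_one, ξ_mul_self]
  simp only [IsIdempotentElem, pairIdem, smul_mul_smul_comm, mul_add, add_mul, one_mul, mul_one,
    hsq, Complex.I_mul_I]
  module

theorem pairIdem_mul_ξ_add (n : ℕ) {j k : Fin n} (h : j ≠ k) :
    pairIdem n j k * ξ n j + ξ n j * pairIdem n j k = ξ n j := by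
  have hanti : ξ n j * ξ n k * ξ n j = -(ξ n j * (ξ n j * ξ n k)) := by
    rw [mul_assoc, ξ_mul_ξ_comm n h.symm, mul_neg]
  simp only [pairIdem, smul_mul_assoc, mul_smul_comm, mul_add, add_mul, one_mul, mul_one, hanti]
  module

/-- the left ideal `Lₙ = 𝒞ₙ·e` has ℂ-dimension `2^⌈n/2⌉`. -/
theorem finrank_Ln (n : ℕ) (hn : 1 ≤ n) :
    Module.finrank ℂ (Ln n) = 2 ^ ((n + 1) / 2) := by
  let a : Fin (n / 2) → Fin n := fun i => ⟨2 * (i : ℕ), by have := i.isLt; omega⟩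
  let b : Fin (n / 2) → Fin n := fun i => ⟨2 * (i : ℕ) + 1, by have := i.isLt; omega⟩
  have hab : ∀ i j, a i ≠ b j := fun i j h => by
    have := congrArg Fin.val h
    simp only [a, b] at this
    omega
  have haa : ∀ i j, i ≠ j → a i ≠ a j := fun i j hij h => hij <| Fin.ext <| by
    have := congrArg Fin.val h
    simp only [a] at this
    omega
  have hbb : ∀ i j, i ≠ j → b i ≠ b j := fun i j hij h => hij <| Fin.ext <| by
    have := congrArg Fin.val h
    simp only [b] at this
    omega
  let p : Fin (n / 2) → Cl n := fun i => pairIdem n (a i) (b i)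
  have he : eIdem n = ((List.finRange (n / 2)).map p).prod := rfl
  have : Module.Finite ℂ (Cl n) := Module.Finite.of_basis (basisCl n)
  have hidem : IsIdempotentElem (eIdem n) := by
    rw [he]
    refine List.isIdempotentElem_prod ?_ ?_
    · simp only [List.mem_map]
      rintro _ ⟨i, -, rfl⟩
      exact isIdempotentElem_pairIdem n (hab i i)
    · simp only [List.mem_map]
      rintro _ ⟨i, -, rfl⟩ _ ⟨j, -, rfl⟩
      rcases eq_or_ne i j with rfl | hij
      · exact Commute.refl _
      · exact commute_pairIdem n (haa i j hij) (hab i j) (hab j i).symm (hbb i j hij)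
  have htr := two_pow_length_mul_tracial_prod
    ((LinearMap.trace ℂ (Cl n)) ∘ₗ (LinearMap.mul ℂ (Cl n)).flip)
    (fun x y => trace_mulRight_mul_comm x y) p (fun i => ξ n (a i)) (fun i => ξ_mul_self n _)
    (fun i => pairIdem_mul_ξ_add n (hab i i))
    (fun i j hij => commute_ξ_pairIdem n (haa i j hij) (hab i j))
    (List.finRange (n / 2)) (List.nodup_finRange _)
  rw [← he, List.length_finRange] at htr
  change 2 ^ (n / 2) * LinearMap.trace ℂ (Cl n) (LinearMap.mulRight ℂ (eIdem n)) =
    LinearMap.trace ℂ (Cl n) (LinearMap.mulRight ℂ 1) at htr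
  rw [trace_mulRight_of_isIdempotentElem hidem, LinearMap.mulRight_one, LinearMap.trace_id,
    finrank_Cl] at htr
  have hdim : 2 ^ (n / 2) * Module.finrank ℂ (Ln n) = 2 ^ n := by exact_mod_cast htr
  have hn2 : n / 2 + (n + 1) / 2 = n := by omega
  refine Nat.eq_of_mul_eq_mul_left (pow_pos two_pos (n / 2)) ?_
  rw [hdim, ← pow_add, hn2]

end CliffordSpin
end
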